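/- arXiv:1804.10721 — 4 statements merged into one kernel-verified Lean document; each statement's English description precedes it below -/
import Mathlib

section
/- Let G ∈ 𝒜 be an asymptotically parabolic function on (a,∞) with G(u) → ∞ as u → ∞, with scale function s_G = (G'')^{−1/2}, and let b : (a,∞) → (0,∞) be a measurable function flat with respect to G, i.e. b(u + w·s_G(u))/b(u) → 1 as u → ∞ locally uniformly in w ∈ ℝ. Then (log b(u))/G(u) → 0 as u → ∞. -/
open MeasureTheory Set Filter

noncomputable section

/-- `G` is asymptotically parabolic on the interval `(a, ∞)` (with `a ∈ [-∞, ∞)` an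
extended real): `G` is twice continuously differentiable there, `G'' > 0` there, and
`G''(u + w (G''(u))^{-1/2}) / G''(u) → 1` as `u → ∞` locally uniformly in `w`. -/
def AsympParabolic (a : EReal) (G : ℝ → ℝ) : Prop :=
  a < ⊤ ∧
  ContDiffOn ℝ 2 G {u : ℝ | a < (u : EReal)} ∧
  (∀ u : ℝ, a < (u : EReal) → 0 < deriv (deriv G) u) ∧
  ∀ W > (0:ℝ), ∀ ε > (0:ℝ), ∃ U : ℝ, ∀ u ≥ U, ∀ w : ℝ, |w| ≤ W →
    |deriv (deriv G) (u + w * (deriv (deriv G) u) ^ (-(1:ℝ)/2)) / deriv (deriv G) u - 1| < ε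

/-- An asymptotically parabolic function is admissible if `G(x)/x → ∞`. -/
def AdmissibleAP (a : EReal) (G : ℝ → ℝ) : Prop :=
  AsympParabolic a G ∧ Tendsto (fun x => G x / x) atTop atTop

/-- The `n`-th moment of a measure `ν` (supported on `[0,∞)`). -/
def Mnu (ν : Measure ℝ) (n : ℕ) : ℝ := ∫ x, x ^ n ∂ν

/-- The complex moment transform `z ↦ ∫₀^∞ x^z dν(x)`. -/
def Mc (ν : Measure ℝ) (z : ℂ) : ℂ := ∫ x in Ioi (0:ℝ), (x : ℂ) ^ z ∂ν

/-- The real moment transform `u ↦ ∫₀^∞ x^u dν(x)`. -/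
def Mr (ν : Measure ℝ) (u : ℝ) : ℝ := ∫ x in Ioi (0:ℝ), x ^ u ∂ν

/-- `η(n) = ((log M_ν)''(n))^{1/2}`. -/
def eta (ν : Measure ℝ) (n : ℕ) : ℝ :=
  Real.sqrt (deriv (deriv fun u : ℝ => Real.log (Mr ν u)) (n : ℝ))

/-- The (topological) support of `ν` is exactly `[0, ∞)`. -/
def SupportIsIci (ν : Measure ℝ) : Prop :=
  ν (Iio (0:ℝ)) = 0 ∧ ∀ x : ℝ, 0 ≤ x → ∀ ε > (0:ℝ), 0 < ν (Ioo (x - ε) (x + ε))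

/-- `ν` is moment determinate: any nonnegative Borel measure on `[0,∞)` with the same
(finite) moment sequence equals `ν`. -/
def MomentDeterminate (ν : Measure ℝ) : Prop :=
  ∀ μ : Measure ℝ, μ (Iio (0:ℝ)) = 0 → (∀ n : ℕ, Integrable (fun x => x ^ n) μ) →
    (∀ n : ℕ, Mnu μ n = Mnu ν n) → μ = ν

/-- `ν` is moment indeterminate. -/
def MomentIndeterminate (ν : Measure ℝ) : Prop := ¬ MomentDeterminate ν

/-- If `G` is monotone on `[U, ∞)` and grows by at least `1/4` along each step `x ↦ x + s x`,
while `L` varies by at most `ε` within a step, then the variation of `L` is controlled by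
that of `G`. -/
lemma abs_sub_le_of_step {G L s : ℝ → ℝ} {U ε : ℝ} (hε : 0 ≤ ε)
    (hmono : MonotoneOn G (Ici U)) (hs : ∀ x ≥ U, 0 < s x)
    (hstep : ∀ x ≥ U, G x + 1 / 4 ≤ G (x + s x))
    (hL : ∀ x ≥ U, ∀ y ∈ Icc x (x + s x), |L y - L x| ≤ ε) (u : ℝ) (n : ℕ) :
    ∀ x ≥ U, x ≤ u → G u - G x < n / 4 → |L u - L x| ≤ n * ε := by
  induction n with
  | zero =>
    intro x hx hxu h
    have := hmono hx (hx.trans hxu) hxu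
    simp only [Nat.cast_zero, zero_div] at h
    linarith
  | succ n ih =>
    intro x hx hxu h
    push_cast at h ⊢
    have hn : 0 ≤ n * ε := by positivity
    rcases le_total u (x + s x) with hu | hu
    · linarith [hL x hx u ⟨hxu, hu⟩]
    · have hsx := hs x hx
      have h1 := ih (x + s x) (by linarith) hu (by linarith [hstep x hx])
      have h2 := hL x hx (x + s x) ⟨by linarith, le_rfl⟩
      linarith [abs_sub_le (L u) (L (x + s x)) (L x)]

/-- A second-order lower bound for a function with nonnegative initial slope and second
derivative at least `m`. -/
lemma add_sq_le_of_le_deriv2 {G : ℝ → ℝ} {x h m : ℝ} (hh : 0 ≤ h)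
    (hG : ∀ y ∈ Icc x (x + h), DifferentiableAt ℝ G y)
    (hG' : ∀ y ∈ Icc x (x + h), DifferentiableAt ℝ (deriv G) y)
    (hx : 0 ≤ deriv G x) (hm : ∀ y ∈ Icc x (x + h), m ≤ deriv (deriv G) y) :
    G x + m / 2 * h ^ 2 ≤ G (x + h) := by
  have hmem : x ∈ Icc x (x + h) := ⟨le_rfl, by linarith⟩
  have hd1 : ∀ y ∈ Icc x (x + h),
      HasDerivAt (fun y => deriv G y - m * (y - x)) (deriv (deriv G) y - m) y := by
    intro y hy
    have h := ((hasDerivAt_id y).sub_const x).const_mul m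
    rw [mul_one] at h
    exact (hG' y hy).hasDerivAt.sub h
  have hmono1 : MonotoneOn (fun y => deriv G y - m * (y - x)) (Icc x (x + h)) := by
    refine monotoneOn_of_deriv_nonneg (convex_Icc _ _)
      (fun y hy => (hd1 y hy).continuousAt.continuousWithinAt)
      (fun y hy => (hd1 y (interior_subset hy)).differentiableAt.differentiableWithinAt) ?_
    intro y hy
    rw [(hd1 y (interior_subset hy)).deriv]
    linarith [hm y (interior_subset hy)]
  have hd2 : ∀ y ∈ Icc x (x + h),
      HasDerivAt (fun y => G y - m / 2 * (y - x) ^ 2) (deriv G y - m * (y - x)) y := by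
    intro y hy
    have h := (((hasDerivAt_id y).sub_const x).pow 2).const_mul (m / 2)
    have he : m / 2 * (((2 : ℕ) : ℝ) * (id y - x) ^ (2 - 1) * 1) = m * (y - x) := by
      norm_num
      ring
    rw [he] at h
    exact (hG y hy).hasDerivAt.sub h
  have hmono2 : MonotoneOn (fun y => G y - m / 2 * (y - x) ^ 2) (Icc x (x + h)) := by
    refine monotoneOn_of_deriv_nonneg (convex_Icc _ _)
      (fun y hy => (hd2 y hy).continuousAt.continuousWithinAt)
      (fun y hy => (hd2 y (interior_subset hy)).differentiableAt.differentiableWithinAt) ?_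
    intro y hy
    have hy' := interior_subset hy
    rw [(hd2 y hy').deriv]
    have := hmono1 hmem hy' hy'.1
    simp only [sub_self, mul_zero, sub_zero] at this
    linarith
  have := hmono2 hmem (⟨by linarith, le_rfl⟩ : x + h ∈ Icc x (x + h)) (by linarith)
  simp only [sub_self, add_sub_cancel_left] at this
  linarith

/-- A function with positive second derivative near infinity that tends to infinity has
eventually nonnegative derivative. -/
lemma exists_deriv_nonneg {G : ℝ → ℝ} {c : ℝ} (hGinf : Tendsto G atTop atTop)
    (hG : ∀ y ≥ c, DifferentiableAt ℝ G y) (hG' : ∀ y ≥ c, DifferentiableAt ℝ (deriv G) y)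
    (hpos : ∀ y ≥ c, 0 < deriv (deriv G) y) :
    ∃ V ≥ c, ∀ y ≥ V, 0 ≤ deriv G y := by
  obtain ⟨d, hd1, hd2⟩ := ((hGinf.eventually_gt_atTop (G c)).and (eventually_gt_atTop c)).exists
  obtain ⟨ξ, hξ, hξ'⟩ := exists_deriv_eq_slope G hd2
    (fun y hy => (hG y hy.1).continuousAt.continuousWithinAt)
    (fun y hy => (hG y hy.1.le).differentiableWithinAt)
  have hξpos : 0 ≤ deriv G ξ := by
    rw [hξ']
    exact div_nonneg (by linarith) (by linarith)
  have hmono : MonotoneOn (deriv G) (Ici c) := by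
    refine monotoneOn_of_deriv_nonneg (convex_Ici _)
      (fun y hy => (hG' y hy).continuousAt.continuousWithinAt)
      (fun y hy => (hG' y (interior_subset hy)).differentiableWithinAt)
      (fun y hy => (hpos y (interior_subset hy)).le)
  exact ⟨ξ, hξ.1.le, fun y hy => hξpos.trans (hmono hξ.1.le (hξ.1.le.trans hy) hy)⟩

/-- **Lemma 3.1(2)**: if `b` is a positive measurable function flat with respect to an
asymptotically parabolic `G` with `G(u) → ∞`, then `log b(u) / G(u) → 0`. -/
theorem flat_log_littleO
    (a : EReal) (G : ℝ → ℝ) (hG : AsympParabolic a G)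
    (hGinf : Tendsto G atTop atTop)
    (b : ℝ → ℝ) (hbmeas : Measurable b)
    (hbpos : ∀ u : ℝ, a < (u : EReal) → 0 < b u)
    (hflat : ∀ W > (0:ℝ), ∀ ε > (0:ℝ), ∃ U : ℝ, ∀ u ≥ U, ∀ w : ℝ, |w| ≤ W →
      |b (u + w * (deriv (deriv G) u) ^ (-(1:ℝ)/2)) / b u - 1| < ε) :
    Tendsto (fun u : ℝ => Real.log (b u) / G u) atTop (nhds 0) := by
  obtain ⟨hatop, hC2, hpos, hpar⟩ := hG
  obtain ⟨c, hac, -⟩ := EReal.lt_iff_exists_real_btwn.1 hatop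
  have hca : ∀ y ≥ c, a < (y : EReal) := fun y hy => hac.trans_le (EReal.coe_le_coe_iff.2 hy)
  have hopen : IsOpen {u : ℝ | a < (u : EReal)} :=
    isOpen_lt continuous_const continuous_coe_real_ereal
  have hdG : ∀ y ≥ c, DifferentiableAt ℝ G y := fun y hy =>
    (hC2.contDiffAt (hopen.mem_nhds (hca y hy))).differentiableAt (by norm_num)
  have hdG' : ∀ y ≥ c, DifferentiableAt ℝ (deriv G) y := fun y hy =>
    ((hC2.deriv_of_isOpen (m := 1) hopen (by norm_num)).contDiffAt
      (hopen.mem_nhds (hca y hy))).differentiableAt (by norm_num)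
  obtain ⟨V, hVc, hV⟩ := exists_deriv_nonneg hGinf hdG hdG' fun y hy => hpos y (hca y hy)
  obtain ⟨U₁, hU₁⟩ := hpar 1 one_pos (1 / 2) (by norm_num)
  set s : ℝ → ℝ := fun u => (deriv (deriv G) u) ^ (-(1:ℝ)/2) with hs
  have hspos : ∀ x ≥ c, 0 < s x := fun x hx => Real.rpow_pos_of_pos (hpos x (hca x hx)) _
  have hssq : ∀ x ≥ c, deriv (deriv G) x * s x ^ 2 = 1 := by
    intro x hx
    have hgx := hpos x (hca x hx)
    simp only [hs]
    rw [← Real.rpow_natCast, ← Real.rpow_mul hgx.le]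
    norm_num [Real.rpow_neg_one, hgx.ne']
  have hparam : ∀ x ≥ c, ∀ y ∈ Icc x (x + s x), ∃ w : ℝ, |w| ≤ 1 ∧ x + w * s x = y := by
    intro x hx y hy
    have hsx := hspos x hx
    refine ⟨(y - x) / s x, ?_, by field_simp; ring⟩
    rw [abs_of_nonneg (div_nonneg (by linarith [hy.1]) hsx.le), div_le_one hsx]
    linarith [hy.2]
  have hmono : MonotoneOn G (Ici V) :=
    monotoneOn_of_deriv_nonneg (convex_Ici _)
      (fun y hy => (hdG y (hVc.trans hy)).continuousAt.continuousWithinAt)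
      (fun y hy => (hdG y (hVc.trans (interior_subset hy))).differentiableWithinAt)
      (fun y hy => hV y (interior_subset hy))
  have hstep : ∀ x ≥ max V U₁, G x + 1 / 4 ≤ G (x + s x) := by
    intro x hx
    have hxV : V ≤ x := (le_max_left _ _).trans hx
    have hxc : c ≤ x := hVc.trans hxV
    have hgx := hpos x (hca x hxc)
    have h := add_sq_le_of_le_deriv2 (G := G) (x := x) (h := s x) (m := deriv (deriv G) x / 2)
      (hspos x hxc).le (fun y hy => hdG y (hxc.trans hy.1)) (fun y hy => hdG' y (hxc.trans hy.1))
      (hV x hxV) (by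
        intro y hy
        obtain ⟨w, hw, rfl⟩ := hparam x hxc y hy
        have h1 := (abs_lt.1 (hU₁ x ((le_max_right _ _).trans hx) w hw)).1
        have h2 : 1 / 2 < deriv (deriv G) (x + w * s x) / deriv (deriv G) x := by
          simp only [hs]
          linarith
        rw [lt_div_iff₀ hgx] at h2
        linarith)
    linarith [hssq x hxc]
  rw [Metric.tendsto_atTop]
  intro ε hε
  obtain ⟨δ, hδ, hlog⟩ := Metric.continuousAt_iff.1 (Real.continuousAt_log one_ne_zero)
    (ε / 8) (by positivity)
  obtain ⟨U₂, hU₂⟩ := hflat 1 one_pos δ hδ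
  set U := max (max V U₁) U₂ with hU
  have hUV : V ≤ U := (le_max_left _ _).trans (le_max_left _ _)
  have hUc : c ≤ U := hVc.trans hUV
  have hL : ∀ x ≥ U, ∀ y ∈ Icc x (x + s x), |Real.log (b y) - Real.log (b x)| ≤ ε / 8 := by
    intro x hx y hy
    have hxc : c ≤ x := hUc.trans hx
    have hby := hbpos y (hca y (hxc.trans hy.1))
    have hbx := hbpos x (hca x hxc)
    obtain ⟨w, hw, rfl⟩ := hparam x hxc y hy
    have h := hlog (x := b (x + w * s x) / b x) (hU₂ x ((le_max_right _ _).trans hx) w hw)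
    rw [Real.log_one, Real.dist_eq, sub_zero, Real.log_div hby.ne' hbx.ne'] at h
    exact h.le
  have hbound : ∀ u ≥ U, |Real.log (b u)| ≤
      |Real.log (b U)| + (4 * (G u - G U) + 1) * (ε / 8) := by
    intro u hu
    have h0 : 0 ≤ 4 * (G u - G U) := by linarith [hmono hUV (hUV.trans hu) hu]
    have h1 := Nat.lt_floor_add_one (4 * (G u - G U))
    have h2 := Nat.floor_le h0
    have h3 := abs_sub_le_of_step (s := s) (by positivity : 0 ≤ ε / 8)
      (hmono.mono (Ici_subset_Ici.2 hUV)) (fun x hx => hspos x (hUc.trans hx))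
      (fun x hx => hstep x ((le_max_left _ _).trans hx)) hL u (⌊4 * (G u - G U)⌋₊ + 1)
      U le_rfl hu (by push_cast; linarith)
    push_cast at h3
    have h4 : (⌊4 * (G u - G U)⌋₊ + 1 : ℝ) * (ε / 8) ≤ (4 * (G u - G U) + 1) * (ε / 8) := by
      gcongr
    have h5 := abs_sub_abs_le_abs_sub (Real.log (b u)) (Real.log (b U))
    linarith
  obtain ⟨N, hN⟩ := eventually_atTop.1 ((hGinf.eventually_gt_atTop 0).and
    (hGinf.eventually_gt_atTop ((|Real.log (b U)| + (1 - 4 * G U) * (ε / 8)) / (ε / 2))))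
  refine ⟨max N U, fun u hu => ?_⟩
  obtain ⟨hG0, hG1⟩ := hN u ((le_max_left _ _).trans hu)
  rw [div_lt_iff₀ (by positivity)] at hG1
  rw [Real.dist_eq, sub_zero, abs_div, abs_of_pos hG0, div_lt_iff₀ hG0]
  linarith [hbound u ((le_max_right _ _).trans hu)]
end
end

section
/- The set of admissible asymptotically parabolic functions is closed under the Legendre transform: if G_* ∈ 𝒜_D is defined on (a,∞), then G_*'(x) → ∞ as x → ∞, the image of (a,∞) under G_*' is an interval (b,∞), and the Legendre transform G(u) = sup_{x>a} {ux − G_*(x)}, restricted to (b,∞), belongs to 𝒜_D; in particular also G'(u) → ∞ as u → ∞. -/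
open MeasureTheory Set Filter

noncomputable section

/-- The Legendre transform of `G` over the interval `(a, ∞)`. -/
def LegendreOn (a : EReal) (G : ℝ → ℝ) : ℝ → ℝ :=
  fun u => sSup ((fun x => u * x - G x) '' {x : ℝ | a < (x : EReal)})

open Topology

theorem EReal.isOpen_setOf_lt_coe (a : EReal) : IsOpen {x : ℝ | a < (x : EReal)} :=
  isOpen_lt continuous_const continuous_coe_real_ereal

theorem EReal.isUpperSet_setOf_lt_coe (a : EReal) : IsUpperSet {x : ℝ | a < (x : EReal)} :=
  fun _ _ hxy hx => lt_of_lt_of_le hx (EReal.coe_le_coe_iff.2 hxy)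

/-- A nonempty upper set of reals without a least element is an open half-line. -/
theorem IsUpperSet.exists_eq_setOf_lt_coe {I : Set ℝ} (hI : IsUpperSet I) (hne : I.Nonempty)
    (hmin : ∀ u ∈ I, ∃ v ∈ I, v < u) :
    ∃ b : EReal, b < ⊤ ∧ I = {u : ℝ | b < (u : EReal)} := by
  refine ⟨sInf ((fun u : ℝ => (u : EReal)) '' I), ?_, ?_⟩
  · obtain ⟨u, hu⟩ := hne
    exact lt_of_le_of_lt (sInf_le (mem_image_of_mem _ hu)) (EReal.coe_lt_top u)
  · ext u
    constructor
    · intro hu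
      obtain ⟨v, hv, hvu⟩ := hmin u hu
      exact lt_of_le_of_lt (sInf_le (mem_image_of_mem _ hv)) (EReal.coe_lt_coe_iff.2 hvu)
    · intro hu
      obtain ⟨_, ⟨v, hv, rfl⟩, hvu⟩ := sInf_lt_iff.1 (mem_ofPred.1 hu)
      exact hI (EReal.coe_lt_coe_iff.1 hvu).le hv

/-- If `g > 0` eventually and `g (u + w (g u)^{-1/2}) / g u → 1` locally uniformly in `w`, then
`u - W (g u)^{-1/2} → ∞` for every `W > 0`. -/
theorem tendsto_sub_mul_rpow_atTop {g : ℝ → ℝ} (hpos : ∀ᶠ u in atTop, 0 < g u)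
    (hg : ∀ W > (0:ℝ), ∀ ε > (0:ℝ), ∃ U : ℝ, ∀ u ≥ U, ∀ w : ℝ, |w| ≤ W →
      |g (u + w * g u ^ (-(1:ℝ)/2)) / g u - 1| < ε) {W : ℝ} (hW : 0 < W) :
    Tendsto (fun u => u - W * g u ^ (-(1:ℝ)/2)) atTop atTop := by
  obtain ⟨U, hU⟩ := hg W hW 1 one_pos
  refine tendsto_atTop.2 fun C => ?_
  obtain ⟨x, hgx, hxC⟩ := (hpos.and (eventually_ge_atTop C)).exists
  set K : ℝ := W * (g x / 2) ^ (-(1:ℝ)/2) with hK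
  filter_upwards [hpos, eventually_ge_atTop U, eventually_gt_atTop (x + K),
    eventually_ge_atTop x] with u hgu huU huK hux
  by_contra! hlt
  set f := g u ^ (-(1:ℝ)/2) with hf
  have hf0 : 0 < f := Real.rpow_pos_of_pos hgu _
  have key := hU u huU (-((u - x) / f)) (by
    rw [abs_neg, abs_of_nonneg (div_nonneg (by linarith) hf0.le), div_le_iff₀ hf0]
    linarith)
  rw [show u + -((u - x) / f) * f = x by field_simp; ring, abs_lt] at key
  have h2 : g x / 2 < g u := by
    have := (div_lt_iff₀ hgu).1 (show g x / g u < 2 by linarith [key.2])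
    linarith
  have h3 : f ≤ (g x / 2) ^ (-(1:ℝ)/2) :=
    Real.rpow_le_rpow_of_nonpos (by positivity) h2.le (by norm_num)
  have : W * f ≤ K := by rw [hK]; gcongr
  linarith

theorem mul_rpow_neg_half {t : ℝ} (ht : 0 < t) : t * t ^ (-(1:ℝ)/2) = t ^ ((1:ℝ)/2) := by
  nth_rewrite 1 [← Real.rpow_one t]
  rw [← Real.rpow_add ht]
  norm_num

namespace AsympParabolic

variable {a : EReal} {G : ℝ → ℝ}

theorem contDiffOn_deriv (h : AsympParabolic a G) :
    ContDiffOn ℝ 1 (deriv G) {x : ℝ | a < (x : EReal)} :=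
  ((contDiffOn_succ_iff_deriv_of_isOpen (n := 1) (EReal.isOpen_setOf_lt_coe a)).1
    (by simpa [one_add_one_eq_two] using h.2.1)).2.2

theorem hasDerivAt (h : AsympParabolic a G) {x : ℝ} (hx : a < (x : EReal)) :
    HasDerivAt G (deriv G x) x :=
  ((h.2.1.differentiableOn (by norm_num)).differentiableAt
    ((EReal.isOpen_setOf_lt_coe a).mem_nhds hx)).hasDerivAt

theorem hasDerivAt_deriv (h : AsympParabolic a G) {x : ℝ} (hx : a < (x : EReal)) :
    HasDerivAt (deriv G) (deriv (deriv G) x) x :=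
  ((h.contDiffOn_deriv.differentiableOn (by norm_num)).differentiableAt
    ((EReal.isOpen_setOf_lt_coe a).mem_nhds hx)).hasDerivAt

theorem continuousOn_deriv_deriv (h : AsympParabolic a G) :
    ContinuousOn (deriv (deriv G)) {x : ℝ | a < (x : EReal)} :=
  h.contDiffOn_deriv.continuousOn_deriv_of_isOpen (EReal.isOpen_setOf_lt_coe a) le_rfl

theorem nonempty (h : AsympParabolic a G) : {x : ℝ | a < (x : EReal)}.Nonempty := by
  obtain ⟨x, hx, -⟩ := EReal.lt_iff_exists_real_btwn.1 h.1
  exact ⟨x, hx⟩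

theorem eventually_mem (h : AsympParabolic a G) : ∀ᶠ x : ℝ in atTop, a < (x : EReal) := by
  obtain ⟨x, hx⟩ := h.nonempty
  filter_upwards [eventually_ge_atTop x] with y hy
  exact EReal.isUpperSet_setOf_lt_coe a hy hx

theorem strictMonoOn_deriv (h : AsympParabolic a G) :
    StrictMonoOn (deriv G) {x : ℝ | a < (x : EReal)} := by
  refine strictMonoOn_of_deriv_pos (EReal.isUpperSet_setOf_lt_coe a).ordConnected.convex
    h.contDiffOn_deriv.continuousOn fun x hx => ?_
  rw [(EReal.isOpen_setOf_lt_coe a).interior_eq] at hx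
  exact h.2.2.1 x hx

/-- The tangent-line inequality. -/
theorem deriv_mul_sub_le (h : AsympParabolic a G) {x y : ℝ} (hx : a < (x : EReal))
    (hy : a < (y : EReal)) : deriv G x * (y - x) ≤ G y - G x := by
  have hup := EReal.isUpperSet_setOf_lt_coe a
  rcases lt_trichotomy x y with hxy | rfl | hxy
  · obtain ⟨c, hc, hceq⟩ := exists_hasDerivAt_eq_slope G (deriv G) hxy
      (h.2.1.continuousOn.mono fun z hz => hup hz.1 hx)
      fun z hz => h.hasDerivAt (hup hz.1.le hx)
    have := h.strictMonoOn_deriv hx (hup hc.1.le hx) hc.1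
    rw [hceq, lt_div_iff₀ (by linarith)] at this
    exact this.le
  · simp
  · obtain ⟨c, hc, hceq⟩ := exists_hasDerivAt_eq_slope G (deriv G) hxy
      (h.2.1.continuousOn.mono fun z hz => hup hz.1 hy)
      fun z hz => h.hasDerivAt (hup hz.1.le hy)
    have := h.strictMonoOn_deriv (hup hc.1.le hy) hx hc.2
    rw [hceq, div_lt_iff₀ (by linarith)] at this
    linarith

/-- At `u = G' x` the supremum defining the Legendre transform is attained at `x`. -/
theorem isGreatest_deriv_mul_sub (h : AsympParabolic a G) {x : ℝ} (hx : a < (x : EReal)) :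
    IsGreatest ((fun y => deriv G x * y - G y) '' {y : ℝ | a < (y : EReal)})
      (deriv G x * x - G x) := by
  refine ⟨mem_image_of_mem _ hx, ?_⟩
  rintro _ ⟨y, hy, rfl⟩
  have := h.deriv_mul_sub_le hx hy
  simp only
  linarith

/-- For large `x`, `G'` sends a window of size `2W (G'' x)^{-1/2}` around `x` onto a set containing
the window of size `W (G'' x)^{1/2}` around `G' x`, and `G''` is almost constant there. -/
theorem eventually_exists_deriv_eq (h : AsympParabolic a G) {W ε : ℝ} (hW : 0 < W) (hε : 0 < ε) :
    ∀ᶠ x in atTop, ∀ w : ℝ, |w| ≤ W → ∃ y : ℝ, a < (y : EReal) ∧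
      deriv G y = deriv G x + w * deriv (deriv G) x ^ ((1:ℝ)/2) ∧
      |deriv (deriv G) y / deriv (deriv G) x - 1| < ε := by
  have hup := EReal.isUpperSet_setOf_lt_coe a
  obtain ⟨U, hU⟩ := h.2.2.2 (2 * W) (by positivity) (min ε (1 / 2)) (by positivity)
  have hpos : ∀ᶠ x in atTop, 0 < deriv (deriv G) x := h.eventually_mem.mono h.2.2.1
  filter_upwards [h.eventually_mem, eventually_ge_atTop U,
    (tendsto_sub_mul_rpow_atTop hpos h.2.2.2 (show 0 < 2 * W by positivity)).eventually
      h.eventually_mem] with x hx hxU hxW w hw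
  have hgx := h.2.2.1 x hx
  have hmul := mul_rpow_neg_half hgx
  set g := deriv (deriv G) with hg
  set f := g x ^ (-(1:ℝ)/2) with hf
  have hf0 : 0 < f := Real.rpow_pos_of_pos hgx _
  have hWf : 0 < 2 * W * f := by positivity
  have hnear : ∀ y ∈ Icc (x - 2 * W * f) (x + 2 * W * f), |g y / g x - 1| < min ε (1 / 2) := by
    intro y hy
    have := hU x hxU ((y - x) / f) (by
      rw [abs_div, abs_of_pos hf0, div_le_iff₀ hf0, abs_le]
      constructor <;> linarith [hy.1, hy.2])
    rwa [← hf, div_mul_cancel₀ _ hf0.ne', add_sub_cancel] at this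
  have hhalf : ∀ y ∈ Icc (x - 2 * W * f) (x + 2 * W * f), g x / 2 ≤ g y := by
    intro y hy
    have := (abs_lt.1 ((hnear y hy).trans_le (min_le_right _ _))).1
    have := (lt_div_iff₀ hgx).1 (show 1 / 2 < g y / g x by linarith)
    linarith
  have hslope : ∀ p q : ℝ, p < q → x - 2 * W * f ≤ p → q ≤ x + 2 * W * f →
      g x / 2 * (q - p) ≤ deriv G q - deriv G p := by
    intro p q hpq hp hq
    obtain ⟨c, hc, hceq⟩ := exists_hasDerivAt_eq_slope (deriv G) g hpq
      (h.contDiffOn_deriv.continuousOn.mono fun z hz => hup (hp.trans hz.1) hxW)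
      fun z hz => h.hasDerivAt_deriv (hup (hp.trans hz.1.le) hxW)
    have := hhalf c ⟨hp.trans hc.1.le, hc.2.le.trans hq⟩
    rwa [hceq, le_div_iff₀ (by linarith)] at this
  have hright := hslope x (x + 2 * W * f) (by linarith) (by linarith) le_rfl
  have hleft := hslope (x - 2 * W * f) x (by linarith) le_rfl (by linarith)
  have hval : g x / 2 * (2 * W * f) = W * g x ^ ((1:ℝ)/2) := by rw [← hmul]; ring
  have hsq : 0 < g x ^ ((1:ℝ)/2) := Real.rpow_pos_of_pos hgx _
  have hwle := mul_le_mul_of_nonneg_right (abs_le.1 hw).2 hsq.le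
  have hlew := mul_le_mul_of_nonneg_right (abs_le.1 hw).1 hsq.le
  rw [add_sub_cancel_left, hval] at hright
  rw [sub_sub_cancel, hval] at hleft
  obtain ⟨y, hy, hyeq⟩ := intermediate_value_Icc
    (show x - 2 * W * f ≤ x + 2 * W * f by linarith)
    (h.contDiffOn_deriv.continuousOn.mono fun z hz => hup hz.1 hxW)
    (show deriv G x + w * g x ^ ((1:ℝ)/2) ∈ Icc _ _ from ⟨by linarith, by linarith⟩)
  exact ⟨y, hup hy.1 hxW, hyeq, (hnear y hy).trans_le (min_le_left _ _)⟩

end AsympParabolic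

namespace AdmissibleAP

variable {a : EReal} {G : ℝ → ℝ}

theorem tendsto_deriv (h : AdmissibleAP a G) : Tendsto (deriv G) atTop atTop := by
  obtain ⟨hG, hlim⟩ := h
  obtain ⟨x, hx⟩ := hG.nonempty
  refine tendsto_atTop.2 fun C => ?_
  filter_upwards [eventually_gt_atTop x, eventually_gt_atTop 0,
    eventually_ge_atTop (|G x - C * x|), hlim.eventually_ge_atTop (C + 1)] with y hxy hy0 hy hGy
  have htan := hG.deriv_mul_sub_le (EReal.isUpperSet_setOf_lt_coe a hxy.le hx) hx
  rw [le_div_iff₀ hy0] at hGy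
  have habs := le_abs_self (G x - C * x)
  by_contra! hlt
  nlinarith

theorem exists_image_deriv_eq (h : AdmissibleAP a G) :
    ∃ b : EReal, b < ⊤ ∧
      deriv G '' {x : ℝ | a < (x : EReal)} = {u : ℝ | b < (u : EReal)} := by
  have hup := EReal.isUpperSet_setOf_lt_coe a
  refine IsUpperSet.exists_eq_setOf_lt_coe ?_ (h.1.nonempty.image _) ?_
  · rintro _ u hu ⟨x, hx, rfl⟩
    obtain ⟨y, hyu, hxy⟩ :=
      ((h.tendsto_deriv.eventually_ge_atTop u).and (eventually_ge_atTop x)).exists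
    obtain ⟨z, hz, hzu⟩ := intermediate_value_Icc hxy
      (h.1.contDiffOn_deriv.continuousOn.mono fun z hz => hup hz.1 hx) ⟨hu, hyu⟩
    exact ⟨z, hup hz.1 hx, hzu⟩
  · rintro _ ⟨x, hx, rfl⟩
    obtain ⟨y, hay, hyx⟩ := EReal.lt_iff_exists_real_btwn.1 hx
    exact ⟨_, mem_image_of_mem _ hay, h.1.strictMonoOn_deriv hay hx (EReal.coe_lt_coe_iff.1 hyx)⟩

end AdmissibleAP

section Legendre

variable {a b : EReal} {G φ : ℝ → ℝ}

theorem AsympParabolic.hasDerivAt_of_rightInverse (h : AsympParabolic a G)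
    (hφ : ∀ u : ℝ, b < (u : EReal) → a < (φ u : EReal) ∧ deriv G (φ u) = u)
    (hb : deriv G '' {x : ℝ | a < (x : EReal)} = {u : ℝ | b < (u : EReal)})
    {u : ℝ} (hu : b < (u : EReal)) :
    HasDerivAt φ (deriv (deriv G) (φ u))⁻¹ u := by
  have hnhds : ∀ᶠ v : ℝ in 𝓝 u, b < (v : EReal) := (EReal.isOpen_setOf_lt_coe b).mem_nhds hu
  have hmono : StrictMonoOn φ {u : ℝ | b < (u : EReal)} := fun v hv w hw hvw => by
    rwa [← h.strictMonoOn_deriv.lt_iff_lt (hφ v hv).1 (hφ w hw).1, (hφ v hv).2, (hφ w hw).2]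
  have himage : φ '' {u : ℝ | b < (u : EReal)} = {x : ℝ | a < (x : EReal)} := by
    refine Subset.antisymm (image_subset_iff.2 fun v hv => (hφ v hv).1) fun x hx => ?_
    have hv : b < ((deriv G x : ℝ) : EReal) := by
      have := mem_image_of_mem (deriv G) (show x ∈ {x : ℝ | a < (x : EReal)} from hx)
      rwa [hb] at this
    exact ⟨_, hv, h.strictMonoOn_deriv.injOn (hφ _ hv).1 hx (hφ _ hv).2⟩
  have hcont : ContinuousAt φ u := hmono.continuousAt_of_image_mem_nhds hnhds <| by
    rw [himage]
    exact (EReal.isOpen_setOf_lt_coe a).mem_nhds (hφ u hu).1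
  exact HasDerivAt.of_local_left_inverse hcont (h.hasDerivAt_deriv (hφ u hu).1)
    (h.2.2.1 _ (hφ u hu).1).ne' (hnhds.mono fun v hv => (hφ v hv).2)

theorem AsympParabolic.legendreOn_eq (h : AsympParabolic a G)
    (hφ : ∀ u : ℝ, b < (u : EReal) → a < (φ u : EReal) ∧ deriv G (φ u) = u)
    {u : ℝ} (hu : b < (u : EReal)) : LegendreOn a G u = u * φ u - G (φ u) := by
  have := (h.isGreatest_deriv_mul_sub (hφ u hu).1).csSup_eq
  rwa [(hφ u hu).2] at this

theorem AsympParabolic.hasDerivAt_legendreOn (h : AsympParabolic a G)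
    (hφ : ∀ u : ℝ, b < (u : EReal) → a < (φ u : EReal) ∧ deriv G (φ u) = u)
    (hb : deriv G '' {x : ℝ | a < (x : EReal)} = {u : ℝ | b < (u : EReal)})
    {u : ℝ} (hu : b < (u : EReal)) : HasDerivAt (LegendreOn a G) (φ u) u := by
  have hnhds : ∀ᶠ v : ℝ in 𝓝 u, b < (v : EReal) := (EReal.isOpen_setOf_lt_coe b).mem_nhds hu
  have hd := h.hasDerivAt_of_rightInverse hφ hb hu
  have h1 := ((hasDerivAt_id u).mul hd).sub ((h.hasDerivAt (hφ u hu).1).comp u hd)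
  rw [(hφ u hu).2] at h1
  refine HasDerivAt.congr_of_eventuallyEq ?_ (hnhds.mono fun v hv => h.legendreOn_eq hφ hv)
  convert h1 using 1
  · rfl
  · simp

theorem AsympParabolic.deriv_deriv_legendreOn (h : AsympParabolic a G)
    (hφ : ∀ u : ℝ, b < (u : EReal) → a < (φ u : EReal) ∧ deriv G (φ u) = u)
    (hb : deriv G '' {x : ℝ | a < (x : EReal)} = {u : ℝ | b < (u : EReal)})
    {u : ℝ} (hu : b < (u : EReal)) :
    deriv (deriv (LegendreOn a G)) u = (deriv (deriv G) (φ u))⁻¹ := by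
  have hnhds : ∀ᶠ v : ℝ in 𝓝 u, b < (v : EReal) := (EReal.isOpen_setOf_lt_coe b).mem_nhds hu
  rw [← (h.hasDerivAt_of_rightInverse hφ hb hu).deriv]
  exact Filter.EventuallyEq.deriv_eq
    (hnhds.mono fun v hv => (h.hasDerivAt_legendreOn hφ hb hv).deriv)

theorem AsympParabolic.contDiffOn_legendreOn (h : AsympParabolic a G)
    (hφ : ∀ u : ℝ, b < (u : EReal) → a < (φ u : EReal) ∧ deriv G (φ u) = u)
    (hb : deriv G '' {x : ℝ | a < (x : EReal)} = {u : ℝ | b < (u : EReal)}) :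
    ContDiffOn ℝ 2 (LegendreOn a G) {u : ℝ | b < (u : EReal)} := by
  have hopen := EReal.isOpen_setOf_lt_coe b
  have hφd : ∀ u ∈ {u : ℝ | b < (u : EReal)}, HasDerivAt φ (deriv (deriv G) (φ u))⁻¹ u :=
    fun u hu => h.hasDerivAt_of_rightInverse hφ hb hu
  have hC1 : ContDiffOn ℝ 1 φ {u : ℝ | b < (u : EReal)} := by
    rw [← zero_add (1 : WithTop ℕ∞), contDiffOn_succ_iff_deriv_of_isOpen hopen]
    refine ⟨fun u hu => (hφd u hu).differentiableAt.differentiableWithinAt, by simp, ?_⟩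
    rw [contDiffOn_zero]
    refine ContinuousOn.congr (f := fun u => (deriv (deriv G) (φ u))⁻¹) ?_
      fun u hu => (hφd u hu).deriv
    exact (h.continuousOn_deriv_deriv.comp
      (fun u hu => (hφd u hu).continuousAt.continuousWithinAt) fun u hu => (hφ u hu).1).inv₀
      fun u hu => (h.2.2.1 _ (hφ u hu).1).ne'
  rw [← one_add_one_eq_two, contDiffOn_succ_iff_deriv_of_isOpen hopen]
  exact ⟨fun u hu => (h.hasDerivAt_legendreOn hφ hb hu).differentiableAt.differentiableWithinAt,
    by simp, hC1.congr fun u hu => (h.hasDerivAt_legendreOn hφ hb hu).deriv⟩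

theorem AsympParabolic.tendsto_rightInverse (h : AsympParabolic a G) (hbt : b < ⊤)
    (hφ : ∀ u : ℝ, b < (u : EReal) → a < (φ u : EReal) ∧ deriv G (φ u) = u) :
    Tendsto φ atTop atTop := by
  refine tendsto_atTop.2 fun C => ?_
  obtain ⟨x, hx, hxC⟩ := (h.eventually_mem.and (eventually_ge_atTop C)).exists
  obtain ⟨v, hv, -⟩ := EReal.lt_iff_exists_real_btwn.1 hbt
  filter_upwards [eventually_ge_atTop v, eventually_ge_atTop (deriv G x)] with u huv hu
  have hbu := EReal.isUpperSet_setOf_lt_coe b huv hv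
  rw [← (hφ u hbu).2, h.strictMonoOn_deriv.le_iff_le hx (hφ u hbu).1] at hu
  exact hxC.trans hu

theorem abs_inv_sub_one_lt {r ε : ℝ} (h : |r - 1| < min (1 / 2) (ε / 2)) : |r⁻¹ - 1| < ε := by
  have h1 := h.trans_le (min_le_left _ _)
  have h2 := h.trans_le (min_le_right _ _)
  have hr : 1 / 2 < r := by linarith [(abs_lt.1 h1).1]
  have hr0 : 0 < r := by linarith
  rw [show r⁻¹ - 1 = -(r - 1) / r by field_simp; ring, abs_div, abs_neg, abs_of_pos hr0,
    div_lt_iff₀ hr0]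
  nlinarith [abs_nonneg (r - 1)]

theorem AsympParabolic.legendreOn (h : AsympParabolic a G) (hbt : b < ⊤)
    (hφ : ∀ u : ℝ, b < (u : EReal) → a < (φ u : EReal) ∧ deriv G (φ u) = u)
    (hb : deriv G '' {x : ℝ | a < (x : EReal)} = {u : ℝ | b < (u : EReal)}) :
    AsympParabolic b (LegendreOn a G) := by
  refine ⟨hbt, h.contDiffOn_legendreOn hφ hb, fun u hu => ?_, fun W hW ε hε => ?_⟩
  · rw [h.deriv_deriv_legendreOn hφ hb hu]
    exact inv_pos.2 (h.2.2.1 _ (hφ u hu).1)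
  obtain ⟨v, hv, -⟩ := EReal.lt_iff_exists_real_btwn.1 hbt
  refine eventually_atTop.1 ?_
  filter_upwards [eventually_ge_atTop v, (h.tendsto_rightInverse hbt hφ).eventually
    (h.eventually_exists_deriv_eq hW (show 0 < min (1 / 2) (ε / 2) by positivity))]
    with u huv hu w hw
  have hbu := EReal.isUpperSet_setOf_lt_coe b huv hv
  obtain ⟨y, hy, hyeq, hyε⟩ := hu w hw
  have hgx := h.2.2.1 _ (hφ u hbu).1
  rw [(hφ u hbu).2] at hyeq
  have hsqrt : ((deriv (deriv G) (φ u))⁻¹) ^ (-(1:ℝ)/2) = deriv (deriv G) (φ u) ^ ((1:ℝ)/2) := by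
    rw [Real.inv_rpow hgx.le, ← Real.rpow_neg hgx.le]
    norm_num
  have hby : b < ((deriv G y : ℝ) : EReal) := by
    have := mem_image_of_mem (deriv G) (show y ∈ {x : ℝ | a < (x : EReal)} from hy)
    rwa [hb] at this
  have hφy : φ (deriv G y) = y :=
    h.strictMonoOn_deriv.injOn (hφ _ hby).1 hy (hφ _ hby).2
  rw [h.deriv_deriv_legendreOn hφ hb hbu, hsqrt, ← hyeq, h.deriv_deriv_legendreOn hφ hb hby, hφy,
    ← inv_div_inv, inv_inv, inv_inv, ← inv_div]
  exact abs_inv_sub_one_lt hyε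

theorem AsympParabolic.tendsto_legendreOn_div (h : AsympParabolic a G) (hbt : b < ⊤)
    (hφ : ∀ u : ℝ, b < (u : EReal) → a < (φ u : EReal) ∧ deriv G (φ u) = u) :
    Tendsto (fun u => LegendreOn a G u / u) atTop atTop := by
  refine tendsto_atTop.2 fun C => ?_
  obtain ⟨x, hx, hxC⟩ := (h.eventually_mem.and (eventually_ge_atTop (C + 1))).exists
  obtain ⟨v, hv, -⟩ := EReal.lt_iff_exists_real_btwn.1 hbt
  filter_upwards [eventually_ge_atTop v, eventually_gt_atTop 0, eventually_ge_atTop (G x)]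
    with u huv hu0 hu
  have hbu := EReal.isUpperSet_setOf_lt_coe b huv hv
  have htan := h.deriv_mul_sub_le (hφ u hbu).1 hx
  rw [(hφ u hbu).2] at htan
  rw [h.legendreOn_eq hφ hbu, le_div_iff₀ hu0]
  nlinarith

end Legendre

/-- **Lemma 3.2**: the set of admissible asymptotically parabolic functions is closed under
the Legendre transform: if `G_* ∈ 𝒜_D` on `(a,∞)` then `G_*'(x) → ∞`, the image of `(a,∞)`
under `G_*'` is an interval `(b,∞)`, and the Legendre transform belongs to `𝒜_D` on `(b,∞)`;
in particular its derivative also tends to `∞`. -/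
theorem admissible_closed_under_legendre
    (a : EReal) (Gs : ℝ → ℝ) (hGs : AdmissibleAP a Gs) :
    Tendsto (deriv Gs) atTop atTop ∧
    ∃ b : EReal,
      (deriv Gs) '' {x : ℝ | a < (x : EReal)} = {u : ℝ | b < (u : EReal)} ∧
      AdmissibleAP b (LegendreOn a Gs) ∧
      Tendsto (deriv (LegendreOn a Gs)) atTop atTop := by
  obtain ⟨b, hbt, hb⟩ := hGs.exists_image_deriv_eq
  have hex : ∀ u : ℝ, ∃ x : ℝ, b < (u : EReal) → a < (x : EReal) ∧ deriv Gs x = u := by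
    intro u
    by_cases hu : b < (u : EReal)
    · obtain ⟨x, hx, hxu⟩ := hb.symm.subset hu
      exact ⟨x, fun _ => ⟨hx, hxu⟩⟩
    · exact ⟨0, fun h => absurd h hu⟩
  choose φ hφ using hex
  have hL := hGs.1.legendreOn hbt hφ hb
  refine ⟨hGs.tendsto_deriv, b, hb, ⟨hL, hGs.1.tendsto_legendreOn_div hbt hφ⟩, ?_⟩
  exact (hGs.1.tendsto_rightInverse hbt hφ).congr'
    (hL.eventually_mem.mono fun u hu => (hGs.1.hasDerivAt_legendreOn hφ hb hu).deriv.symm)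
end
end

section
/- Let b ∈ ℝ, σ > 0, and let Π be a σ-finite positive measure on ℝ with Π({0}) = 0, Π((0,∞)) = 0 and ∫ min(1,r²) dΠ(r) < ∞, and set Ψ(u) = bu + σ²u²/2 + ∫_{−∞}^0 (e^{ur} − 1 − ur·1_{{|r|≤1}}) dΠ(r) for u ≥ 0. Then for u > 0, Ψ''(u) = σ² + ∫_{−∞}^0 r²·e^{ur} dΠ(r) > 0, lim_{u→∞} Ψ''(u) = σ², and for every t > 0 the function u ↦ t·Ψ(u) restricted to (0,∞) is asymptotically parabolic (belongs to 𝒜). -/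
open MeasureTheory Set Filter

noncomputable section

/-- The integrand of the Lévy–Khintchine formula, with the jumps of size at most one compensated. -/
def levyKernel (u r : ℝ) : ℝ := Real.exp (u * r) - 1 - (if |r| ≤ 1 then u * r else 0)

/-- The derivative of `levyKernel` in the variable `u`. -/
def levyKernelDeriv (u r : ℝ) : ℝ := r * Real.exp (u * r) - (if |r| ≤ 1 then r else 0)

theorem measurable_levyKernel (u : ℝ) : Measurable (levyKernel u) := by
  unfold levyKernel
  exact (by fun_prop : Measurable fun r : ℝ => Real.exp (u * r) - 1).sub
    (Measurable.ite (measurableSet_le (by fun_prop) (by fun_prop)) (by fun_prop) (by fun_prop))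

theorem measurable_levyKernelDeriv (u : ℝ) : Measurable (levyKernelDeriv u) := by
  unfold levyKernelDeriv
  exact (by fun_prop : Measurable fun r : ℝ => r * Real.exp (u * r)).sub
    (Measurable.ite (measurableSet_le (by fun_prop) (by fun_prop)) (by fun_prop) (by fun_prop))

theorem hasDerivAt_levyKernel (u r : ℝ) :
    HasDerivAt (fun v => levyKernel v r) (levyKernelDeriv u r) u := by
  have hexp : HasDerivAt (fun v : ℝ => Real.exp (v * r)) (Real.exp (u * r) * (1 * r)) u :=
    ((hasDerivAt_id u).mul_const r).exp
  unfold levyKernel levyKernelDeriv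
  split_ifs
  · exact ((hexp.sub_const 1).sub ((hasDerivAt_id u).mul_const r)).congr_deriv (by ring)
  · exact ((hexp.sub_const 1).sub (hasDerivAt_const u (0 : ℝ))).congr_deriv (by ring)

theorem hasDerivAt_levyKernelDeriv (u r : ℝ) :
    HasDerivAt (fun v => levyKernelDeriv v r) (r ^ 2 * Real.exp (u * r)) u := by
  have hexp : HasDerivAt (fun v : ℝ => Real.exp (v * r)) (Real.exp (u * r) * (1 * r)) u :=
    ((hasDerivAt_id u).mul_const r).exp
  unfold levyKernelDeriv
  exact ((hexp.const_mul r).sub_const (if |r| ≤ 1 then r else 0)).congr_deriv (by ring)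

theorem exp_neg_le_one_sub_add_sq {y : ℝ} (hy : 0 ≤ y) : Real.exp (-y) ≤ 1 - y + y ^ 2 := by
  rw [Real.exp_neg]
  refine inv_le_of_inv_le₀ (by nlinarith [sq_nonneg (y - 1)]) ?_
  refine le_trans ?_ (Real.add_one_le_exp y)
  rw [inv_le_iff_one_le_mul₀ (by nlinarith [sq_nonneg (y - 1)])]
  nlinarith [pow_nonneg hy 3]

theorem mul_exp_neg_le_one (y : ℝ) : y * Real.exp (-y) ≤ 1 := by
  rw [Real.exp_neg, ← div_eq_mul_inv, div_le_one (Real.exp_pos y)]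
  linarith [Real.add_one_le_exp y]

theorem abs_levyKernel_le {u r : ℝ} (hu : 0 ≤ u) (hr : r < 0) :
    |levyKernel u r| ≤ (u ^ 2 + 1) * min 1 (r ^ 2) := by
  have hexp : Real.exp (u * r) ≤ 1 := Real.exp_le_one_iff.2 (by nlinarith)
  have hpos := Real.exp_pos (u * r)
  unfold levyKernel
  rw [abs_of_neg hr]
  split_ifs with h
  · rw [min_eq_right (by nlinarith)]
    have hupper := exp_neg_le_one_sub_add_sq (y := -(u * r)) (by nlinarith)
    rw [neg_neg] at hupper
    rw [abs_le]
    constructor <;> nlinarith [Real.add_one_le_exp (u * r), sq_nonneg (u * r), sq_nonneg r]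
  · rw [min_eq_left (by nlinarith), abs_le]
    constructor <;> nlinarith [sq_nonneg u]

theorem abs_levyKernelDeriv_le {c u r : ℝ} (hc : 0 < c) (hcu : c ≤ u) (hr : r < 0) :
    |levyKernelDeriv u r| ≤ (u + 1 / c) * min 1 (r ^ 2) := by
  have hexp : Real.exp (u * r) ≤ 1 := Real.exp_le_one_iff.2 (by nlinarith)
  have hpos := Real.exp_pos (u * r)
  have hcinv : 0 < 1 / c := by positivity
  unfold levyKernelDeriv
  rw [abs_of_neg hr]
  split_ifs with h
  · rw [min_eq_right (by nlinarith), ← mul_sub_one, abs_mul, abs_of_neg hr,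
      abs_of_nonpos (by linarith)]
    nlinarith [mul_le_mul_of_nonneg_left (Real.add_one_le_exp (u * r)) (neg_nonneg.2 hr.le),
      mul_nonneg hcinv.le (sq_nonneg r)]
  · rw [min_eq_left (by nlinarith), sub_zero, abs_mul, abs_of_neg hr, abs_of_pos hpos]
    have hle := mul_exp_neg_le_one (-(u * r))
    rw [neg_neg] at hle
    have : -r * Real.exp (u * r) ≤ 1 / c := by
      rw [le_div_iff₀ hc]
      nlinarith [mul_nonneg (neg_nonneg.2 hr.le) hpos.le]
    linarith

theorem sq_mul_exp_le {c u r : ℝ} (hc : 0 < c) (hcu : c ≤ u) (hr : r < 0) :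
    r ^ 2 * Real.exp (u * r) ≤ (1 + 4 / c ^ 2) * min 1 (r ^ 2) := by
  have hexp : Real.exp (u * r) ≤ 1 := Real.exp_le_one_iff.2 (by nlinarith)
  have hcinv : 0 < 4 / c ^ 2 := by positivity
  rcases le_total (r ^ 2) 1 with h | h
  · rw [min_eq_right h]
    nlinarith [sq_nonneg r, mul_nonneg hcinv.le (sq_nonneg r)]
  · rw [min_eq_left h]
    have hle := mul_exp_neg_le_one (-(c * r / 2))
    have hsq : (-(c * r / 2) * Real.exp (c * r / 2)) ^ 2 ≤ 1 := by
      rw [neg_neg] at hle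
      refine pow_le_one₀ (mul_nonneg (by nlinarith) (Real.exp_pos _).le) hle
    have hmono : Real.exp (u * r) ≤ Real.exp (c * r) := Real.exp_le_exp.2 (by nlinarith)
    have hdouble : Real.exp (c * r) = Real.exp (c * r / 2) ^ 2 := by
      rw [← Real.exp_nat_mul]
      congr 1
      push_cast
      ring
    have : r ^ 2 * Real.exp (c * r) ≤ 4 / c ^ 2 := by
      rw [le_div_iff₀ (by positivity), hdouble]
      nlinarith
    nlinarith [mul_le_mul_of_nonneg_left hmono (sq_nonneg r)]

section Integrals

variable {μ : Measure ℝ}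

theorem integrable_levyKernel (hμ : ∀ᵐ r ∂μ, r < 0)
    (hint : Integrable (fun r : ℝ => min 1 (r ^ 2)) μ) {u : ℝ} (hu : 0 ≤ u) :
    Integrable (levyKernel u) μ := by
  refine (hint.const_mul (u ^ 2 + 1)).mono' (measurable_levyKernel u).aestronglyMeasurable ?_
  filter_upwards [hμ] with r hr using abs_levyKernel_le hu hr

theorem integrable_levyKernelDeriv (hμ : ∀ᵐ r ∂μ, r < 0)
    (hint : Integrable (fun r : ℝ => min 1 (r ^ 2)) μ) {u : ℝ} (hu : 0 < u) :
    Integrable (levyKernelDeriv u) μ := by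
  refine (hint.const_mul (u + 1 / u)).mono' (measurable_levyKernelDeriv u).aestronglyMeasurable ?_
  filter_upwards [hμ] with r hr using abs_levyKernelDeriv_le hu le_rfl hr

theorem hasDerivAt_integral_levyKernel (hμ : ∀ᵐ r ∂μ, r < 0)
    (hint : Integrable (fun r : ℝ => min 1 (r ^ 2)) μ) {u : ℝ} (hu : 0 < u) :
    HasDerivAt (fun v => ∫ r, levyKernel v r ∂μ) (∫ r, levyKernelDeriv u r ∂μ) u := by
  refine (hasDerivAt_integral_of_dominated_loc_of_deriv_le
    (bound := fun r => (2 * u + 1 / (u / 2)) * min 1 (r ^ 2))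
    (Icc_mem_nhds (by linarith : u / 2 < u) (by linarith : u < 2 * u))
    (Eventually.of_forall fun v => (measurable_levyKernel v).aestronglyMeasurable)
    (integrable_levyKernel hμ hint hu.le) (measurable_levyKernelDeriv u).aestronglyMeasurable
    ?_ (hint.const_mul _) (Eventually.of_forall fun r v _ => hasDerivAt_levyKernel v r)).2
  filter_upwards [hμ] with r hr v hv
  refine (abs_levyKernelDeriv_le (half_pos hu) hv.1 hr).trans ?_
  gcongr
  exact hv.2

theorem hasDerivAt_integral_levyKernelDeriv (hμ : ∀ᵐ r ∂μ, r < 0)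
    (hint : Integrable (fun r : ℝ => min 1 (r ^ 2)) μ) {u : ℝ} (hu : 0 < u) :
    HasDerivAt (fun v => ∫ r, levyKernelDeriv v r ∂μ) (∫ r, r ^ 2 * Real.exp (u * r) ∂μ) u := by
  refine (hasDerivAt_integral_of_dominated_loc_of_deriv_le
    (bound := fun r => (1 + 4 / (u / 2) ^ 2) * min 1 (r ^ 2))
    (Ici_mem_nhds (by linarith : u / 2 < u))
    (Eventually.of_forall fun v => (measurable_levyKernelDeriv v).aestronglyMeasurable)
    (integrable_levyKernelDeriv hμ hint hu) (by fun_prop)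
    ?_ (hint.const_mul _) (Eventually.of_forall fun r v _ => hasDerivAt_levyKernelDeriv v r)).2
  filter_upwards [hμ] with r hr v hv
  rw [Real.norm_of_nonneg (by positivity)]
  exact sq_mul_exp_le (half_pos hu) hv hr

theorem continuousAt_integral_sq_mul_exp (hμ : ∀ᵐ r ∂μ, r < 0)
    (hint : Integrable (fun r : ℝ => min 1 (r ^ 2)) μ) {u : ℝ} (hu : 0 < u) :
    ContinuousAt (fun v => ∫ r, r ^ 2 * Real.exp (v * r) ∂μ) u := by
  refine continuousAt_of_dominated (bound := fun r => (1 + 4 / (u / 2) ^ 2) * min 1 (r ^ 2))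
    (Eventually.of_forall fun v => by fun_prop) ?_ (hint.const_mul _)
    (Eventually.of_forall fun r => by fun_prop)
  filter_upwards [Ici_mem_nhds (by linarith : u / 2 < u)] with v hv
  filter_upwards [hμ] with r hr
  rw [Real.norm_of_nonneg (by positivity)]
  exact sq_mul_exp_le (half_pos hu) hv hr

theorem tendsto_integral_sq_mul_exp (hμ : ∀ᵐ r ∂μ, r < 0)
    (hint : Integrable (fun r : ℝ => min 1 (r ^ 2)) μ) :
    Tendsto (fun v => ∫ r, r ^ 2 * Real.exp (v * r) ∂μ) atTop (nhds 0) := by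
  rw [← integral_zero ℝ ℝ (μ := μ)]
  refine tendsto_integral_filter_of_dominated_convergence
    (fun r => (1 + 4 / (1 : ℝ) ^ 2) * min 1 (r ^ 2))
    (Eventually.of_forall fun v => by fun_prop) ?_ (hint.const_mul _) ?_
  · filter_upwards [eventually_ge_atTop 1] with v hv
    filter_upwards [hμ] with r hr
    rw [Real.norm_of_nonneg (by positivity)]
    exact sq_mul_exp_le one_pos hv hr
  · filter_upwards [hμ] with r hr
    simpa using (Real.tendsto_exp_atBot.comp
      (tendsto_id.atTop_mul_const_of_neg hr)).const_mul (r ^ 2)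

end Integrals

/-- A function with a continuous second derivative that is bounded below by its positive limit
at infinity is asymptotically parabolic. -/
theorem asympParabolic_of_tendsto {a L : ℝ} (hL : 0 < L) {G G' G'' : ℝ → ℝ}
    (hG : ∀ u, a < u → HasDerivAt G (G' u) u) (hG' : ∀ u, a < u → HasDerivAt G' (G'' u) u)
    (hcont : ContinuousOn G'' (Ioi a)) (hle : ∀ u, a < u → L ≤ G'' u)
    (hlim : Tendsto G'' atTop (nhds L)) : AsympParabolic (a : EReal) G := by
  have hderiv : ∀ u, a < u → deriv G u = G' u := fun u hu => (hG u hu).deriv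
  have hderiv2 : ∀ u, a < u → deriv (deriv G) u = G'' u := fun u hu =>
    ((hG' u hu).congr_of_eventuallyEq (by
      filter_upwards [Ioi_mem_nhds hu] with v hv using hderiv v hv)).deriv
  have hset : {u : ℝ | (a : EReal) < (u : EReal)} = Ioi a := by
    ext u
    simp
  refine ⟨EReal.coe_lt_top a, ?_, fun u hu => ?_, fun W hW ε hε => ?_⟩
  · rw [hset]
    have hC1 : ContDiffOn ℝ 1 G' (Ioi a) := by
      rw [← zero_add (1 : WithTop ℕ∞), contDiffOn_succ_iff_deriv_of_isOpen isOpen_Ioi]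
      refine ⟨fun u hu => (hG' u hu).differentiableAt.differentiableWithinAt, by simp, ?_⟩
      exact contDiffOn_zero.2 (hcont.congr fun u hu => (hG' u hu).deriv)
    rw [← one_add_one_eq_two, contDiffOn_succ_iff_deriv_of_isOpen isOpen_Ioi]
    exact ⟨fun u hu => (hG u hu).differentiableAt.differentiableWithinAt, by simp,
      hC1.congr hderiv⟩
  · have hu' : a < u := EReal.coe_lt_coe_iff.1 hu
    rw [hderiv2 u hu']
    exact hL.trans_le (hle u hu')
  · obtain ⟨N, hN⟩ := Metric.tendsto_atTop.1 hlim (ε * L / 2) (by positivity)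
    have hM : 0 < L ^ (-(1 : ℝ) / 2) := Real.rpow_pos_of_pos hL _
    refine ⟨max N (a + 1) + W * L ^ (-(1 : ℝ) / 2), fun u hu w hw => ?_⟩
    have hWM : 0 < W * L ^ (-(1 : ℝ) / 2) := mul_pos hW hM
    have hNm := le_max_left N (a + 1)
    have ham := le_max_right N (a + 1)
    have hua : a < u := by linarith
    rw [hderiv2 u hua]
    have hpos : 0 < G'' u := hL.trans_le (hle u hua)
    have hstep : |w * G'' u ^ (-(1 : ℝ) / 2)| ≤ W * L ^ (-(1 : ℝ) / 2) := by
      rw [abs_mul, abs_of_pos (Real.rpow_pos_of_pos hpos _)]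
      exact mul_le_mul hw (Real.rpow_le_rpow_of_nonpos hL (hle u hua) (by norm_num))
        (Real.rpow_pos_of_pos hpos _).le hW.le
    have hshift := neg_le_of_abs_le hstep
    set v := u + w * G'' u ^ (-(1 : ℝ) / 2) with hv
    rw [hderiv2 v (by linarith)]
    have hdu := hN u (by linarith)
    have hdv := hN v (by linarith)
    rw [Real.dist_eq, abs_lt] at hdu hdv
    rw [div_sub_one hpos.ne', abs_div, abs_of_pos hpos, div_lt_iff₀ hpos]
    refine lt_of_lt_of_le (b := ε * L) ?_ (mul_le_mul_of_nonneg_left (hle u hua) hε.le)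
    rw [abs_lt]
    constructor <;> linarith

/-- For a spectrally-negative Lévy exponent `Ψ` with Gaussian coefficient `σ² > 0`:
`Ψ''(u) = σ² + ∫_{-∞}^0 r² e^{ur} dΠ(r) > 0`, `Ψ''(u) → σ²` as `u → ∞`, and for every
`t > 0` the function `u ↦ tΨ(u)` is asymptotically parabolic on `(0,∞)`. -/
theorem levy_exponent_asympParabolic
    (b σ : ℝ) (hσ : 0 < σ)
    (Pim : Measure ℝ) [SigmaFinite Pim] (hPi0 : Pim {0} = 0)
    (hPipos : Pim (Ioi (0:ℝ)) = 0)
    (hPiint : ∫⁻ r, ENNReal.ofReal (min 1 (r ^ 2)) ∂Pim < ⊤)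
    (Ψ : ℝ → ℝ)
    (hΨ : ∀ u : ℝ, 0 ≤ u → Ψ u = b * u + σ ^ 2 * u ^ 2 / 2 +
      ∫ r in Iio (0:ℝ), (Real.exp (u * r) - 1 - (if |r| ≤ 1 then u * r else 0)) ∂Pim) :
    (∀ u : ℝ, 0 < u →
      deriv (deriv Ψ) u = σ ^ 2 + ∫ r in Iio (0:ℝ), r ^ 2 * Real.exp (u * r) ∂Pim ∧
      0 < deriv (deriv Ψ) u) ∧
    Tendsto (fun u : ℝ => deriv (deriv Ψ) u) atTop (nhds (σ ^ 2)) ∧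
    ∀ t : ℝ, 0 < t → AsympParabolic ((0 : ℝ) : EReal) (fun u => t * Ψ u) := by
  set μ := Pim.restrict (Iio (0 : ℝ))
  have hμ : ∀ᵐ r ∂μ, r < 0 := ae_restrict_mem measurableSet_Iio
  have hint : Integrable (fun r : ℝ => min 1 (r ^ 2)) μ := by
    refine Integrable.mono_measure ⟨by fun_prop, ?_⟩ Measure.restrict_le_self
    rw [hasFiniteIntegral_iff_ofReal (Eventually.of_forall fun r => by positivity)]
    exact hPiint
  set J : ℝ → ℝ := fun u => ∫ r, r ^ 2 * Real.exp (u * r) ∂μ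
  have hJ : ∀ u, 0 ≤ J u := fun u => integral_nonneg fun r => by positivity
  set Ψ' : ℝ → ℝ := fun u => b + σ ^ 2 * u + ∫ r, levyKernelDeriv u r ∂μ
  have hderiv : ∀ u, 0 < u → HasDerivAt Ψ (Ψ' u) u := by
    intro u hu
    have hpoly : HasDerivAt (fun v : ℝ => b * v + σ ^ 2 * v ^ 2 / 2) (b + σ ^ 2 * u) u := by
      refine (((hasDerivAt_id u).const_mul b).add
        ((((hasDerivAt_id u).pow 2).const_mul (σ ^ 2)).div_const 2)).congr_deriv ?_
      simp only [id_eq]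
      ring
    refine (hpoly.add (hasDerivAt_integral_levyKernel hμ hint hu)).congr_of_eventuallyEq ?_
    filter_upwards [Ioi_mem_nhds hu] with v hv using hΨ v (le_of_lt hv)
  have hderiv' : ∀ u, 0 < u → HasDerivAt Ψ' (σ ^ 2 + J u) u := by
    intro u hu
    have hlin : HasDerivAt (fun v : ℝ => b + σ ^ 2 * v) (σ ^ 2) u := by
      simpa using ((hasDerivAt_id u).const_mul (σ ^ 2)).const_add b
    exact hlin.add (hasDerivAt_integral_levyKernelDeriv hμ hint hu)
  have hsecond : ∀ u, 0 < u → deriv (deriv Ψ) u = σ ^ 2 + J u := fun u hu =>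
    ((hderiv' u hu).congr_of_eventuallyEq (by
      filter_upwards [Ioi_mem_nhds hu] with v hv using (hderiv v hv).deriv)).deriv
  have hlim : Tendsto (fun u => σ ^ 2 + J u) atTop (nhds (σ ^ 2)) := by
    simpa using (tendsto_integral_sq_mul_exp hμ hint).const_add (σ ^ 2)
  refine ⟨fun u hu => ⟨hsecond u hu, ?_⟩, hlim.congr' ?_, fun t ht => ?_⟩
  · rw [hsecond u hu]
    have := hJ u
    positivity
  · filter_upwards [eventually_gt_atTop 0] with u hu using (hsecond u hu).symm
  · refine asympParabolic_of_tendsto (L := t * σ ^ 2) (G' := fun u => t * Ψ' u)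
      (G'' := fun u => t * (σ ^ 2 + J u)) (by positivity)
      (fun u hu => (hderiv u hu).const_mul t) (fun u hu => (hderiv' u hu).const_mul t)
      (fun u hu => ?_) (fun u _ => ?_) (hlim.const_mul t)
    · exact (continuousAt_const.mul (continuousAt_const.add
        (continuousAt_integral_sq_mul_exp hμ hint hu))).continuousWithinAt
    · exact mul_le_mul_of_nonneg_left (le_add_of_nonneg_right (hJ u)) ht.le
end
end

section
/- Let β > 0 and let ν be a probability measure on [0,∞) with support equal to [0,∞), absolutely continuous with density f, and suppose there exist constants C ≥ 1 and A > 0 such that C^{−1}·exp(−x^β) ≤ f(x) ≤ C·exp(−x^β) for all x ≥ A. Then all positive moments of ν are finite, and ν is moment determinate if and only if β ≥ 1/2. -/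
open MeasureTheory Set Filter

noncomputable section

open ProbabilityTheory Topology

/-- Two finite measures on `ℝ` with the same moments are equal if both have exponential moments
in a neighbourhood of `0`. -/
theorem measure_ext_of_moments_eq {μ ν : Measure ℝ} [IsFiniteMeasure μ] [IsFiniteMeasure ν]
    (hμ : 0 ∈ interior (integrableExpSet id μ)) (hν : 0 ∈ interior (integrableExpSet id ν))
    (h : ∀ n : ℕ, ∫ x, x ^ n ∂μ = ∫ x, x ^ n ∂ν) : μ = ν := by
  have hmgf : ∀ᶠ t in 𝓝 (0 : ℝ), mgf id μ t = mgf id ν t := by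
    have h1 := (hasFPowerSeriesAt_mgf hμ).eventually_hasSum
    have h2 := (hasFPowerSeriesAt_mgf hν).eventually_hasSum
    filter_upwards [h1, h2] with t h1 h2
    simp only [id_eq, zero_mul, Real.exp_zero, mul_one, h, zero_add] at h1 h2
    exact h1.unique h2
  have hX : AnalyticOnNhd ℂ (complexMGF id μ)
      {z | z.re ∈ interior (integrableExpSet id μ) ∩ interior (integrableExpSet id ν)} :=
    fun z hz => analyticOnNhd_complexMGF z hz.1
  have hY : AnalyticOnNhd ℂ (complexMGF id ν)
      {z | z.re ∈ interior (integrableExpSet id μ) ∩ interior (integrableExpSet id ν)} :=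
    fun z hz => analyticOnNhd_complexMGF z hz.2
  have hEq := AnalyticOnNhd.eqOn_of_preconnected_of_frequently_eq hX hY
    ((convex_integrableExpSet.interior.inter
      convex_integrableExpSet.interior).linear_preimage Complex.reLm).isPreconnected
    (z₀ := ((0 : ℝ) : ℂ)) ⟨by simpa using hμ, by simpa using hν⟩ (by
      have h_real : ∃ᶠ (x : ℝ) in 𝓝[≠] 0, complexMGF id μ x = complexMGF id ν x := by
        refine Eventually.frequently ?_
        filter_upwards [nhdsWithin_le_nhds hmgf] with x hx
        rw [complexMGF_ofReal, complexMGF_ofReal, hx]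
      refine Tendsto.frequently (f := fun x : ℝ => (x : ℂ)) ?_ h_real
      refine tendsto_nhdsWithin_iff.2
        ⟨(Complex.continuous_ofReal.tendsto 0).mono_left nhdsWithin_le_nhds, ?_⟩
      filter_upwards [self_mem_nhdsWithin] with x hx
      simpa using hx)
  refine Measure.ext_of_charFun (funext fun t => ?_)
  rw [← complexMGF_id_mul_I, ← complexMGF_id_mul_I]
  exact hEq ⟨by simpa using hμ, by simpa using hν⟩

theorem ae_nonneg_of_measure_Iio_zero {μ : Measure ℝ} (h : μ (Iio (0 : ℝ)) = 0) :
    ∀ᵐ x ∂μ, 0 ≤ x := by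
  filter_upwards [measure_eq_zero_iff_ae_notMem.1 h] with x hx using not_lt.1 hx

theorem lintegral_cosh_sqrt {μ : Measure ℝ} (h0 : μ (Iio (0 : ℝ)) = 0)
    (hint : ∀ n : ℕ, Integrable (fun x => x ^ n) μ) (c : ℝ) :
    ∫⁻ x, ENNReal.ofReal (Real.cosh (c * √x)) ∂μ
      = ∑' n : ℕ, ENNReal.ofReal (c ^ (2 * n) / (2 * n).factorial * ∫ x, x ^ n ∂μ) := by
  have hpos := ae_nonneg_of_measure_Iio_zero h0
  have hterm : ∀ᵐ x ∂μ, ENNReal.ofReal (Real.cosh (c * √x))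
      = ∑' n : ℕ, ENNReal.ofReal (c ^ (2 * n) / (2 * n).factorial * x ^ n) := by
    filter_upwards [hpos] with x hx
    have hs : HasSum (fun n : ℕ => c ^ (2 * n) / (2 * n).factorial * x ^ n)
        (Real.cosh (c * √x)) := by
      convert! Real.hasSum_cosh (c * √x) using 2 with n
      rw [mul_pow, pow_mul (√x), Real.sq_sqrt hx]
      ring
    rw [← hs.tsum_eq, ENNReal.ofReal_tsum_of_nonneg _ hs.summable]
    intro n
    rw [pow_mul]
    positivity
  rw [lintegral_congr_ae hterm, lintegral_tsum (fun n => by fun_prop)]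
  refine tsum_congr fun n => ?_
  rw [← integral_const_mul, ofReal_integral_eq_lintegral_ofReal ((hint n).const_mul _)]
  filter_upwards [hpos] with x hx
  rw [pow_mul]
  positivity

/-- The image of a measure on `[0, ∞)` under the two-valued map `x ↦ ±√x`. -/
def symmSqrt (μ : Measure ℝ) : Measure ℝ :=
  μ.map (fun x => √x) + μ.map (fun x => -√x)

instance (μ : Measure ℝ) [IsFiniteMeasure μ] : IsFiniteMeasure (symmSqrt μ) := by
  unfold symmSqrt; infer_instance

theorem zero_mem_interior_integrableExpSet_symmSqrt {μ : Measure ℝ} {c : ℝ} (hc : 0 < c)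
    (h : Integrable (fun x => Real.cosh (c * √x)) μ) :
    0 ∈ interior (integrableExpSet id (symmSqrt μ)) := by
  refine mem_interior.2 ⟨Ioo (-c) c, ?_, isOpen_Ioo, by simpa using hc⟩
  have key : ∀ t ∈ Ioo (-c) c, Integrable (fun x => Real.exp (t * √x)) μ := by
    intro t ht
    refine (h.const_mul 2).mono' (by fun_prop) (ae_of_all _ fun x => ?_)
    rw [Real.norm_eq_abs, Real.abs_exp, Real.cosh_eq]
    have h1 : t * √x ≤ c * √x := mul_le_mul_of_nonneg_right ht.2.le (Real.sqrt_nonneg x)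
    have := Real.exp_le_exp.2 h1
    have := Real.exp_pos (-(c * √x))
    linarith
  intro t ht
  have ht' : -t ∈ Ioo (-c) c := ⟨by linarith [ht.2], by linarith [ht.1]⟩
  simp only [integrableExpSet, mem_ofPred_eq, id_eq]
  unfold symmSqrt
  refine Integrable.add_measure ?_ ?_
  · rw [integrable_map_measure (by fun_prop) (by fun_prop)]
    exact key t ht
  · rw [integrable_map_measure (by fun_prop) (by fun_prop)]
    refine (key _ ht').congr (ae_of_all _ fun x => ?_)
    simp

theorem integrable_sqrt_pow {μ : Measure ℝ} [IsFiniteMeasure μ]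
    (hint : ∀ n : ℕ, Integrable (fun x => x ^ n) μ) (n : ℕ) :
    Integrable (fun x => √x ^ n) μ := by
  refine ((integrable_const (1 : ℝ)).add (hint n).norm).mono' (by fun_prop) (ae_of_all _ fun x => ?_)
  rw [Real.norm_of_nonneg (by positivity)]
  simp only [Pi.add_apply, norm_pow, Real.norm_eq_abs]
  have : √x ≤ max 1 |x| := by
    rw [Real.sqrt_le_iff]
    refine ⟨by positivity, ?_⟩
    rcases le_total 1 |x| with h | h
    · rw [max_eq_right h]; nlinarith [le_abs_self x]
    · rw [max_eq_left h]; linarith [le_abs_self x]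
  have h2 := pow_le_pow_left₀ (Real.sqrt_nonneg x) this n
  rcases le_total 1 |x| with h | h
  · rw [max_eq_right h] at h2; linarith
  · rw [max_eq_left h, one_pow] at h2
    have : 0 ≤ |x| ^ n := by positivity
    linarith

theorem integral_pow_symmSqrt {μ : Measure ℝ} [IsFiniteMeasure μ] (h0 : μ (Iio (0 : ℝ)) = 0)
    (hint : ∀ n : ℕ, Integrable (fun x => x ^ n) μ) (n : ℕ) :
    ∫ x, x ^ n ∂(symmSqrt μ) = if Even n then 2 * ∫ x, x ^ (n / 2) ∂μ else 0 := by
  have hi := integrable_sqrt_pow hint n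
  unfold symmSqrt
  rw [integral_add_measure, integral_map (by fun_prop) (by fun_prop),
    integral_map (by fun_prop) (by fun_prop)]
  rotate_left
  · rw [integrable_map_measure (by fun_prop) (by fun_prop)]
    exact hi
  · rw [integrable_map_measure (by fun_prop) (by fun_prop)]
    refine (hi.const_mul ((-1) ^ n)).congr (ae_of_all _ fun x => ?_)
    simp only [Function.comp_apply]
    rw [← mul_pow, neg_one_mul]
  split_ifs with hn
  · simp_rw [hn.neg_pow]
    rw [← two_mul]
    congr 1
    refine integral_congr_ae ?_
    filter_upwards [ae_nonneg_of_measure_Iio_zero h0] with x hx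
    nth_rewrite 1 [← Nat.two_mul_div_two_of_even hn]
    rw [pow_mul, Real.sq_sqrt hx]
  · simp_rw [(Nat.not_even_iff_odd.1 hn).neg_pow]
    rw [integral_neg, add_neg_cancel]

theorem map_sq_symmSqrt {μ : Measure ℝ} (h0 : μ (Iio (0 : ℝ)) = 0) :
    (symmSqrt μ).map (fun x => x ^ 2) = μ + μ := by
  have h : ∀ᵐ x ∂μ, (√x) ^ 2 = x := by
    filter_upwards [ae_nonneg_of_measure_Iio_zero h0] with x hx using Real.sq_sqrt hx
  unfold symmSqrt
  rw [Measure.map_add _ _ (by fun_prop), Measure.map_map (by fun_prop) (by fun_prop),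
    Measure.map_map (by fun_prop) (by fun_prop)]
  have e1 : μ.map ((fun x : ℝ => x ^ 2) ∘ fun x => √x) = μ := by
    rw [Measure.map_congr (g := id), Measure.map_id]
    exact h
  have e2 : μ.map ((fun x : ℝ => x ^ 2) ∘ fun x => -√x) = μ := by
    rw [Measure.map_congr (g := id), Measure.map_id]
    filter_upwards [h] with x hx
    simpa using hx
  rw [e1, e2]

/-- Hardy's criterion for the Stieltjes moment problem. -/
theorem eq_of_moments_eq_of_integrable_cosh_sqrt {μ ν : Measure ℝ}
    (hμ0 : μ (Iio (0 : ℝ)) = 0) (hν0 : ν (Iio (0 : ℝ)) = 0)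
    (hμ : ∀ n : ℕ, Integrable (fun x => x ^ n) μ) (hν : ∀ n : ℕ, Integrable (fun x => x ^ n) ν)
    (h : ∀ n : ℕ, ∫ x, x ^ n ∂μ = ∫ x, x ^ n ∂ν) {c : ℝ} (hc : 0 < c)
    (hcosh : Integrable (fun x => Real.cosh (c * √x)) ν) : μ = ν := by
  have : IsFiniteMeasure μ := by
    have := hμ 0
    simpa [integrable_const_iff] using this
  have : IsFiniteMeasure ν := by
    have := hν 0
    simpa [integrable_const_iff] using this
  have hcosh' : Integrable (fun x => Real.cosh (c * √x)) μ := by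
    have hm : Measurable fun x : ℝ => Real.cosh (c * √x) :=
      Real.measurable_cosh.comp (by fun_prop)
    refine ⟨hm.aestronglyMeasurable, ?_⟩
    rw [hasFiniteIntegral_iff_ofReal (ae_of_all _ fun x => (Real.cosh_pos _).le),
      lintegral_cosh_sqrt hμ0 hμ]
    simp_rw [h]
    rw [← lintegral_cosh_sqrt hν0 hν]
    exact (hasFiniteIntegral_iff_ofReal (ae_of_all _ fun x => (Real.cosh_pos _).le)).1 hcosh.2
  have hs : symmSqrt μ = symmSqrt ν :=
    measure_ext_of_moments_eq (zero_mem_interior_integrableExpSet_symmSqrt hc hcosh')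
      (zero_mem_interior_integrableExpSet_symmSqrt hc hcosh) fun n => by
        rw [integral_pow_symmSqrt hμ0 hμ, integral_pow_symmSqrt hν0 hν, h]
  have h2 : μ + μ = ν + ν := by rw [← map_sq_symmSqrt hμ0, hs, map_sq_symmSqrt hν0]
  ext s _
  have h3 := congrArg (fun m : Measure ℝ => m s) h2
  simp only [Measure.add_apply, ← two_mul] at h3
  exact (ENNReal.mul_right_inj (by simp) (by simp)).1 h3

/-- The Gamma integral with a complex scale parameter. -/
theorem integral_rpow_mul_cexp_neg_mul_Ioi {a : ℝ} (ha : 0 < a) {w : ℂ} (hw : 0 < w.re) :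
    ∫ t in Ioi (0 : ℝ), ((t ^ (a - 1) : ℝ) : ℂ) * Complex.exp (-(w * t))
      = (1 / w) ^ (a : ℂ) * Complex.Gamma a := by
  set m : Measure ℝ := (volume.restrict (Ioi (0 : ℝ))).withDensity
    (fun t => ENNReal.ofReal (t ^ (a - 1))) with hm
  have hmeas : Measurable fun t : ℝ => ENNReal.ofReal (t ^ (a - 1)) := by fun_prop
  have hF : ∀ z : ℂ, complexMGF id m z
      = ∫ t in Ioi (0 : ℝ), ((t ^ (a - 1) : ℝ) : ℂ) * Complex.exp (z * t) := by
    intro z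
    rw [complexMGF, hm, integral_withDensity_eq_integral_toReal_smul hmeas
      (ae_of_all _ fun x => ENNReal.ofReal_lt_top)]
    refine setIntegral_congr_fun measurableSet_Ioi fun t ht => ?_
    have : 0 ≤ t ^ (a - 1) := Real.rpow_nonneg (le_of_lt ht) _
    simp [ENNReal.toReal_ofReal this]
  have hsub : Iio (0 : ℝ) ⊆ interior (integrableExpSet id m) := by
    refine interior_maximal ?_ isOpen_Iio
    intro r hr
    simp only [integrableExpSet, mem_ofPred_eq, hm]
    rw [integrable_withDensity_iff_integrable_smul' hmeas
      (ae_of_all _ fun x => ENNReal.ofReal_lt_top)]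
    have := integrableOn_rpow_mul_exp_neg_mul_rpow (p := 1) (s := a - 1) (b := -r) (by linarith)
      one_pos (neg_pos.2 hr)
    refine this.congr_fun (fun t ht => ?_) measurableSet_Ioi
    have : 0 ≤ t ^ (a - 1) := Real.rpow_nonneg (le_of_lt ht) _
    simp [ENNReal.toReal_ofReal this]
  have hX : AnalyticOnNhd ℂ (complexMGF id m) {z | z.re < 0} :=
    fun z hz => analyticOnNhd_complexMGF z (hsub hz)
  have hopen : IsOpen {z : ℂ | z.re < 0} := isOpen_lt Complex.continuous_re continuous_const
  have hY : AnalyticOnNhd ℂ (fun z : ℂ => (1 / (-z)) ^ (a : ℂ) * Complex.Gamma a)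
      {z | z.re < 0} := by
    refine DifferentiableOn.analyticOnNhd (fun z hz => ?_) hopen
    have hz' : z.re < 0 := hz
    have hne : -z ≠ 0 := by
      intro h
      have : z = 0 := neg_eq_zero.1 h
      simp [this] at hz'
    refine DifferentiableAt.differentiableWithinAt ?_
    refine DifferentiableAt.mul_const (DifferentiableAt.cpow_const ?_ ?_) _
    · exact (differentiableAt_const _).div differentiableAt_id.neg hne
    · refine Or.inl ?_
      rw [one_div, Complex.inv_re]
      exact div_pos (by simpa using hz') (Complex.normSq_pos.2 hne)
  have hEq := AnalyticOnNhd.eqOn_of_preconnected_of_frequently_eq hX hY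
    (convex_halfSpace_re_lt 0).isPreconnected (z₀ := ((-1 : ℝ) : ℂ)) (by simp) (by
      have h_real : ∃ᶠ (x : ℝ) in 𝓝[≠] (-1), complexMGF id m x
          = (1 / (-(x : ℂ))) ^ (a : ℂ) * Complex.Gamma a := by
        refine Eventually.frequently ?_
        filter_upwards [nhdsWithin_le_nhds (Iio_mem_nhds (show (-1 : ℝ) < 0 by norm_num))] with x hx
        have := Complex.integral_cpow_mul_exp_neg_mul_Ioi (a := a) (r := -x) (by simpa using ha)
          (neg_pos.2 hx)
        rw [Complex.ofReal_neg] at this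
        rw [hF, ← this]
        refine setIntegral_congr_fun measurableSet_Ioi fun t ht => ?_
        simp only [neg_mul, neg_neg]
        rw [Complex.ofReal_cpow (le_of_lt ht)]
        simp
      refine Tendsto.frequently (f := fun x : ℝ => (x : ℂ)) ?_ h_real
      refine tendsto_nhdsWithin_iff.2
        ⟨(Complex.continuous_ofReal.tendsto _).mono_left nhdsWithin_le_nhds, ?_⟩
      filter_upwards [self_mem_nhdsWithin] with x hx
      simpa [← Complex.ofReal_one, ← Complex.ofReal_neg, -Complex.ofReal_one] using hx)
  have := hEq (show (-w) ∈ {z : ℂ | z.re < 0} by simpa using hw)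
  simp only [neg_neg] at this
  rw [← this, hF]
  simp

/-- Stieltjes' function, all of whose moments on `(0, ∞)` vanish for `0 < γ < 1 / 2`. -/
def stieltjesNull (γ y : ℝ) : ℝ :=
  Real.exp (-Real.cos (Real.pi * γ) * y ^ γ) * Real.sin (Real.sin (Real.pi * γ) * y ^ γ)

theorem cos_pi_mul_pos {γ : ℝ} (hγ : 0 < γ) (hγ' : γ < 1 / 2) : 0 < Real.cos (Real.pi * γ) := by
  have := Real.pi_pos
  exact Real.cos_pos_of_mem_Ioo ⟨by nlinarith, by nlinarith⟩

theorem abs_stieltjesNull_le (γ y : ℝ) :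
    |stieltjesNull γ y| ≤ Real.exp (-Real.cos (Real.pi * γ) * y ^ γ) := by
  rw [stieltjesNull, abs_mul, Real.abs_exp]
  exact mul_le_of_le_one_right (Real.exp_pos _).le (Real.abs_sin_le_one _)

theorem measurable_stieltjesNull (γ : ℝ) : Measurable (stieltjesNull γ) := by
  unfold stieltjesNull
  fun_prop

theorem integrableOn_pow_mul_stieltjesNull {γ : ℝ} (hγ : 0 < γ) (hγ' : γ < 1 / 2) (n : ℕ) :
    IntegrableOn (fun y => y ^ n * stieltjesNull γ y) (Ioi 0) := by
  have h := integrableOn_rpow_mul_exp_neg_mul_rpow (s := n) (by linarith [n.cast_nonneg (α := ℝ)])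
    hγ (cos_pi_mul_pos hγ hγ')
  refine Integrable.mono' h
    (((measurable_id.pow_const n).mul (measurable_stieltjesNull γ)).aestronglyMeasurable) ?_
  refine (ae_restrict_iff' measurableSet_Ioi).2 (ae_of_all _ fun y hy => ?_)
  rw [Real.norm_eq_abs, abs_mul, abs_of_pos (pow_pos hy n), Real.rpow_natCast]
  exact mul_le_mul_of_nonneg_left (abs_stieltjesNull_le γ y) (pow_pos hy n).le

theorem integral_pow_mul_stieltjesNull {γ : ℝ} (hγ : 0 < γ) (hγ' : γ < 1 / 2) (n : ℕ) :
    ∫ y in Ioi (0 : ℝ), y ^ n * stieltjesNull γ y = 0 := by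
  set θ := Real.pi * γ with hθ
  set a : ℝ := (n + 1) / γ with ha
  have ha0 : 0 < a := by positivity
  set w : ℂ := Complex.exp (-(θ * Complex.I)) with hw
  have hwre : w.re = Real.cos θ := by
    rw [hw, Complex.exp_re]; simp
  have hwim : w.im = -Real.sin θ := by
    rw [hw, Complex.exp_im]; simp
  have hc := cos_pi_mul_pos hγ hγ'
  have key : ∫ y in Ioi (0 : ℝ), (γ : ℂ) * ((y : ℂ) ^ n * Complex.exp (-(w * (y ^ γ : ℝ))))
      = (-1) ^ (n + 1) * Complex.Gamma a := by
    have h1 := integral_comp_rpow_Ioi_of_pos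
      (g := fun t : ℝ => ((t ^ (a - 1) : ℝ) : ℂ) * Complex.exp (-(w * t))) hγ
    rw [integral_rpow_mul_cexp_neg_mul_Ioi ha0 (by rw [hwre]; exact hc)] at h1
    have h2 : (1 / w) ^ (a : ℂ) = (-1) ^ (n + 1) := by
      rw [hw, one_div, ← Complex.exp_neg, neg_neg, Complex.cpow_def_of_ne_zero (Complex.exp_ne_zero _),
        Complex.log_exp, ← Complex.exp_pi_mul_I, ← Complex.exp_nat_mul]
      · congr 1
        have : (γ : ℂ) ≠ 0 := by exact_mod_cast hγ.ne'
        rw [hθ, ha]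
        push_cast
        field_simp
      · simp only [Complex.mul_im, Complex.ofReal_re, Complex.I_im, Complex.ofReal_im, Complex.I_re]
        have := Real.pi_pos
        nlinarith
      · simp only [Complex.mul_im, Complex.ofReal_re, Complex.I_im, Complex.ofReal_im, Complex.I_re]
        have := Real.pi_pos
        nlinarith
    rw [h2] at h1
    rw [← h1]
    refine setIntegral_congr_fun measurableSet_Ioi fun y hy => ?_
    have hy : 0 < y := hy
    have h3 : y ^ (γ - 1) * (y ^ γ) ^ (a - 1) = y ^ n := by
      rw [← Real.rpow_mul hy.le, ← Real.rpow_add hy, ← Real.rpow_natCast]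
      congr 1
      rw [ha]
      field_simp
      ring
    simp only [Complex.real_smul]
    rw [← mul_assoc, ← mul_assoc, ← Complex.ofReal_mul, mul_assoc γ, h3]
    push_cast
    ring
  have hint : IntegrableOn
      (fun y : ℝ => (γ : ℂ) * ((y : ℂ) ^ n * Complex.exp (-(w * (y ^ γ : ℝ))))) (Ioi 0) := by
    refine Integrable.const_mul ?_ _
    have h := integrableOn_rpow_mul_exp_neg_mul_rpow (s := n)
      (by linarith [n.cast_nonneg (α := ℝ)]) hγ hc
    refine Integrable.mono' h (Measurable.aestronglyMeasurable (by fun_prop)) ?_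
    refine (ae_restrict_iff' measurableSet_Ioi).2 (ae_of_all _ fun y hy => ?_)
    have hy : 0 < y := hy
    rw [norm_mul, norm_pow, Complex.norm_real, Complex.norm_exp, Real.norm_of_nonneg hy.le,
      Real.rpow_natCast, Complex.neg_re, Complex.re_mul_ofReal, hwre, neg_mul]
  have him := congrArg Complex.im key
  rw [← RCLike.im_eq_complex_im, ← integral_im hint] at him
  have h4 : ∀ y : ℝ, RCLike.im ((γ : ℂ) * ((y : ℂ) ^ n * Complex.exp (-(w * (y ^ γ : ℝ)))))
      = γ * (y ^ n * stieltjesNull γ y) := by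
    intro y
    rw [RCLike.im_eq_complex_im, Complex.im_ofReal_mul, ← Complex.ofReal_pow,
      Complex.im_ofReal_mul, Complex.exp_im, Complex.neg_re, Complex.neg_im, Complex.re_mul_ofReal,
      Complex.im_mul_ofReal, hwre, hwim, stieltjesNull, neg_mul, neg_neg, neg_mul]
  simp_rw [h4] at him
  rw [integral_const_mul, Complex.Gamma_ofReal] at him
  have h5 : RCLike.im ((-1 : ℂ) ^ (n + 1) * ((Real.Gamma a : ℝ) : ℂ)) = 0 := by
    have : (-1 : ℂ) ^ (n + 1) * ((Real.Gamma a : ℝ) : ℂ)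
        = (((-1 : ℝ) ^ (n + 1) * Real.Gamma a : ℝ) : ℂ) := by push_cast; ring
    rw [this]
    exact Complex.ofReal_im ((-1) ^ (n + 1) * Real.Gamma a)
  rw [h5] at him
  exact (mul_eq_zero.1 him).resolve_left hγ.ne'

theorem exists_stieltjesNull_ne_zero {γ : ℝ} (hγ : 0 < γ) (hγ' : γ < 1 / 2) :
    ∃ y > 0, stieltjesNull γ y ≠ 0 := by
  have hs : 0 < Real.sin (Real.pi * γ) :=
    Real.sin_pos_of_pos_of_lt_pi (by positivity) (by nlinarith [Real.pi_pos])
  refine ⟨(Real.pi / 2 / Real.sin (Real.pi * γ)) ^ γ⁻¹,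
    Real.rpow_pos_of_pos (by positivity) _, ?_⟩
  rw [stieltjesNull, Real.rpow_inv_rpow (by positivity) hγ.ne', mul_div_cancel₀ _ hs.ne',
    Real.sin_pi_div_two, mul_one]
  exact Real.exp_ne_zero _

theorem integrableOn_pow_mul_stieltjesNull_sub {γ : ℝ} (hγ : 0 < γ) (hγ' : γ < 1 / 2) (A : ℝ)
    (n : ℕ) :
    IntegrableOn (fun x => x ^ n * stieltjesNull γ (x - A)) (Ioi A) ∧
      ∫ x in Ioi A, x ^ n * stieltjesNull γ (x - A) = 0 := by
  have hmp : MeasurePreserving (fun y : ℝ => y + A) volume volume :=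
    measurePreserving_add_right volume A
  have hemb : MeasurableEmbedding (fun y : ℝ => y + A) := measurableEmbedding_addRight A
  have hpre : (fun y : ℝ => y + A) ⁻¹' Ioi A = Ioi 0 := by ext y; simp
  have hexp : ∀ y : ℝ, (y + A) ^ n * stieltjesNull γ (y + A - A)
      = ∑ k ∈ Finset.range (n + 1), A ^ (n - k) * n.choose k * (y ^ k * stieltjesNull γ y) := by
    intro y
    rw [add_sub_cancel_right, add_pow, Finset.sum_mul]
    exact Finset.sum_congr rfl fun k _ => by ring
  have hi : ∀ k ∈ Finset.range (n + 1), IntegrableOn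
      (fun y => A ^ (n - k) * n.choose k * (y ^ k * stieltjesNull γ y)) (Ioi 0) :=
    fun k _ => (integrableOn_pow_mul_stieltjesNull hγ hγ' k).const_mul _
  constructor
  · rw [← hmp.integrableOn_comp_preimage hemb, hpre]
    refine (integrable_finsetSum _ hi).congr (ae_of_all _ fun y => ?_)
    exact (hexp y).symm
  · rw [← hmp.setIntegral_preimage_emb hemb, hpre]
    simp_rw [hexp]
    rw [integral_finsetSum _ hi]
    refine Finset.sum_eq_zero fun k _ => ?_
    rw [integral_const_mul, integral_pow_mul_stieltjesNull hγ hγ', mul_zero]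

theorem add_rpow_le_mul_rpow_add {β γ b A y : ℝ} (hβ : 0 < β) (hβ1 : β ≤ 1) (hβγ : β < γ)
    (hb : 0 < b) (hA : 0 ≤ A) (hy : 0 < y) :
    (y + A) ^ β ≤ b * y ^ γ + ((b⁻¹ ^ (γ - β)⁻¹) ^ β + A ^ β) := by
  have h1 : (y + A) ^ β ≤ y ^ β + A ^ β := Real.rpow_add_le_add_rpow hy.le hA hβ.le hβ1
  have h2 : y ^ β ≤ b * y ^ γ + (b⁻¹ ^ (γ - β)⁻¹) ^ β := by
    have hδ : 0 < γ - β := sub_pos.2 hβγ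
    have hY : 0 < b⁻¹ ^ (γ - β)⁻¹ := Real.rpow_pos_of_pos (inv_pos.2 hb) _
    rcases le_total y (b⁻¹ ^ (γ - β)⁻¹) with h | h
    · have := Real.rpow_le_rpow hy.le h hβ.le
      have : 0 < b * y ^ γ := mul_pos hb (Real.rpow_pos_of_pos hy _)
      linarith
    · have h3 := Real.rpow_le_rpow hY.le h hδ.le
      rw [Real.rpow_inv_rpow (inv_pos.2 hb).le hδ.ne'] at h3
      have h4 : y ^ γ = y ^ (γ - β) * y ^ β := by rw [← Real.rpow_add hy]; congr 1; ring
      have h5 : 1 ≤ b * y ^ (γ - β) := by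
        have := mul_le_mul_of_nonneg_left h3 hb.le
        rwa [mul_inv_cancel₀ hb.ne'] at this
      have h6 := mul_le_mul_of_nonneg_right h5 (Real.rpow_pos_of_pos hy β).le
      have := Real.rpow_pos_of_pos hY β
      rw [h4]
      linarith
  linarith

theorem exists_mul_abs_stieltjesNull_le {β γ A c : ℝ} (hβ : 0 < β) (hβγ : β < γ)
    (hγ' : γ < 1 / 2) (hA : 0 ≤ A) (hc : 0 < c) :
    ∃ δ > 0, ∀ x > A, δ * |stieltjesNull γ (x - A)| ≤ c * Real.exp (-(x ^ β)) := by
  have hb := cos_pi_mul_pos (hβ.trans hβγ) hγ'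
  set b := Real.cos (Real.pi * γ) with hbdef
  refine ⟨c * Real.exp (-((b⁻¹ ^ (γ - β)⁻¹) ^ β + A ^ β)), by positivity, fun x hx => ?_⟩
  rw [mul_assoc]
  refine mul_le_mul_of_nonneg_left ?_ hc.le
  refine (mul_le_mul_of_nonneg_left (abs_stieltjesNull_le γ _) (Real.exp_pos _).le).trans ?_
  rw [← Real.exp_add, Real.exp_le_exp, ← hbdef]
  have := add_rpow_le_mul_rpow_add hβ (by linarith) hβγ hb hA (sub_pos.2 hx)
  rw [sub_add_cancel] at this
  linarith

theorem not_momentDeterminate_of_withDensity_le {ν : Measure ℝ} [IsFiniteMeasure ν]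
    (hν0 : ν (Iio (0 : ℝ)) = 0) (hint : ∀ n : ℕ, Integrable (fun x => x ^ n) ν)
    {β c A : ℝ} (hβ : 0 < β) (hβ' : β < 1 / 2) (hc : 0 < c) (hA : 0 ≤ A)
    (hle : (volume.restrict (Ioi A)).withDensity
      (fun x => ENNReal.ofReal (c * Real.exp (-(x ^ β)))) ≤ ν) :
    ¬ MomentDeterminate ν := by
  intro hdet
  obtain ⟨γ, hβγ, hγ'⟩ := exists_between hβ'
  have hγ := hβ.trans hβγ
  obtain ⟨δ, hδ, hbound⟩ := exists_mul_abs_stieltjesNull_le hβ hβγ hγ' hA hc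
  set k : ℝ → ℝ := fun x => c * Real.exp (-(x ^ β)) with hk
  set h : ℝ → ℝ := fun x => δ * stieltjesNull γ (x - A) with hh
  have hkm : Measurable k := by fun_prop
  have hhm : Measurable h :=
    ((measurable_stieltjesNull γ).comp (measurable_id.sub_const A)).const_mul δ
  have hkh : ∀ x > A, |h x| ≤ k x := fun x hx => by
    rw [hh, abs_mul, abs_of_pos hδ]; exact hbound x hx
  set ρ := (volume.restrict (Ioi A)).withDensity (fun x => ENNReal.ofReal (k x)) with hρ
  set κ := (volume.restrict (Ioi A)).withDensity (fun x => ENNReal.ofReal (k x + h x)) with hκ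
  have : IsFiniteMeasure ρ := isFiniteMeasure_of_le ν hle
  set σ := ν - ρ with hσ
  have hσν : σ ≤ ν := Measure.sub_le
  have : IsFiniteMeasure σ := isFiniteMeasure_of_le ν hσν
  have hsum : σ + ρ = ν := Measure.sub_add_cancel_of_le hle
  have hiρ : ∀ n : ℕ, Integrable (fun x => x ^ n) ρ := fun n => (hint n).mono_measure hle
  have hiσ : ∀ n : ℕ, Integrable (fun x => x ^ n) σ := fun n => (hint n).mono_measure hσν
  have hkint : ∀ n : ℕ, IntegrableOn (fun x => k x * x ^ n) (Ioi A) := by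
    intro n
    have := hiρ n
    rw [hρ, integrable_withDensity_iff_integrable_smul' (by fun_prop)
      (ae_of_all _ fun x => ENNReal.ofReal_lt_top)] at this
    refine this.congr (ae_of_all _ fun x => ?_)
    simp only [smul_eq_mul]
    rw [ENNReal.toReal_ofReal (by positivity)]
  have hhint : ∀ n : ℕ, IntegrableOn (fun x => h x * x ^ n) (Ioi A) ∧
      ∫ x in Ioi A, h x * x ^ n = 0 := by
    intro n
    have hn := integrableOn_pow_mul_stieltjesNull_sub hγ hγ' A n
    have he : ∀ x, h x * x ^ n = δ * (x ^ n * stieltjesNull γ (x - A)) := fun x => by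
      rw [hh]; ring
    simp_rw [he]
    refine ⟨hn.1.const_mul _, ?_⟩
    rw [integral_const_mul, hn.2, mul_zero]
  have hκcongr : ∀ n : ℕ, ∀ x ∈ Ioi A,
      (ENNReal.ofReal (k x + h x)).toReal • x ^ n = k x * x ^ n + h x * x ^ n := by
    intro n x hx
    rw [ENNReal.toReal_ofReal (by linarith [neg_le_of_abs_le (hkh x hx)]), smul_eq_mul, add_mul]
  have hiκ : ∀ n : ℕ, Integrable (fun x => x ^ n) κ := by
    intro n
    rw [hκ, integrable_withDensity_iff_integrable_smul' (by fun_prop)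
      (ae_of_all _ fun x => ENNReal.ofReal_lt_top)]
    exact IntegrableOn.congr_fun ((hkint n).add (hhint n).1)
      (fun x hx => (hκcongr n x hx).symm) measurableSet_Ioi
  have hmom : ∀ n : ℕ, ∫ x, x ^ n ∂κ = ∫ x, x ^ n ∂ρ := by
    intro n
    rw [hκ, hρ, integral_withDensity_eq_integral_toReal_smul (by fun_prop)
      (ae_of_all _ fun x => ENNReal.ofReal_lt_top),
      integral_withDensity_eq_integral_toReal_smul (by fun_prop)
      (ae_of_all _ fun x => ENNReal.ofReal_lt_top),
      setIntegral_congr_fun measurableSet_Ioi (hκcongr n),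
      integral_add (hkint n) (hhint n).1, (hhint n).2, add_zero]
    refine integral_congr_ae (ae_of_all _ fun x => ?_)
    simp only [smul_eq_mul]
    rw [ENNReal.toReal_ofReal (by positivity)]
  have hκ0 : κ (Iio (0 : ℝ)) = 0 := by
    rw [hκ, withDensity_apply _ measurableSet_Iio, Measure.restrict_restrict measurableSet_Iio]
    have : Iio (0 : ℝ) ∩ Ioi A = ∅ := by
      ext x
      simp only [mem_inter_iff, mem_Iio, mem_Ioi, mem_empty_iff_false, iff_false, not_and, not_lt]
      intro hx; linarith
    simp [this]
  have heq : σ + κ = ν := by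
    refine hdet _ ?_ (fun n => (hiσ n).add_measure (hiκ n)) fun n => ?_
    · rw [Measure.add_apply, hκ0, add_zero]
      exact le_antisymm ((hσν _).trans hν0.le) bot_le
    · unfold Mnu
      rw [integral_add_measure (hiσ n) (hiκ n), hmom, ← integral_add_measure (hiσ n) (hiρ n), hsum]
  have heq2 : κ = ρ := (Measure.add_right_inj σ _ _).1 (heq.trans hsum.symm)
  have hfin : ∫⁻ x in Ioi A, ENNReal.ofReal (k x + h x) ≠ ⊤ := by
    have h1 : κ univ = ∫⁻ x in Ioi A, ENNReal.ofReal (k x + h x) := by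
      rw [hκ, withDensity_apply _ MeasurableSet.univ, Measure.restrict_univ]
    rw [← h1, heq2]
    exact measure_ne_top ρ univ
  have hae := (withDensity_eq_iff (by fun_prop) (by fun_prop) hfin).1 heq2
  have hae0 : h =ᵐ[volume.restrict (Ioi A)] fun _ => 0 := by
    filter_upwards [hae, ae_restrict_mem measurableSet_Ioi] with x hx hxA
    have hk0 : 0 ≤ k x := by positivity
    rw [ENNReal.ofReal_eq_ofReal_iff (by linarith [neg_le_of_abs_le (hkh x hxA)]) hk0] at hx
    linarith
  have hcont : Continuous h := by
    rw [hh]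
    unfold stieltjesNull
    have : Continuous fun x : ℝ => (x - A) ^ γ :=
      (Real.continuous_rpow_const hγ.le).comp (continuous_id.sub continuous_const)
    fun_prop
  have hzero := Measure.eqOn_open_of_ae_eq hae0 isOpen_Ioi hcont.continuousOn continuousOn_const
  obtain ⟨y, hy, hy0⟩ := exists_stieltjesNull_ne_zero hγ hγ'
  have h1 := hzero (show y + A ∈ Ioi A by simpa using hy)
  simp only [hh, add_sub_cancel_right, mul_eq_zero] at h1
  exact h1.elim hδ.ne' hy0

/-- A function is integrable against a measure on `[0, ∞)` if it is bounded near `0` and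
integrable against an upper bound for the tail of the measure. -/
theorem integrable_of_restrict_Ioi_le_withDensity {ν : Measure ℝ} [IsFiniteMeasure ν]
    (hν0 : ν (Iio (0 : ℝ)) = 0) {A B : ℝ} (hA : 0 ≤ A) {u F : ℝ → ℝ}
    (hu : Measurable u) (hu0 : ∀ x, 0 ≤ u x) (hF : Measurable F)
    (hle : ν.restrict (Ioi A) ≤
      (volume.restrict (Ioi A)).withDensity (fun x => ENNReal.ofReal (u x)))
    (hbdd : ∀ x ∈ Icc 0 A, |F x| ≤ B) (hint : IntegrableOn (fun x => F x * u x) (Ioi 0)) :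
    Integrable F ν := by
  have h1 : IntegrableOn F (Ioi A) ν := by
    refine Integrable.mono_measure ?_ hle
    rw [integrable_withDensity_iff_integrable_smul' (by fun_prop)
      (ae_of_all _ fun x => ENNReal.ofReal_lt_top)]
    refine (hint.mono_set (Ioi_subset_Ioi hA)).congr (ae_of_all _ fun x => ?_)
    simp only [smul_eq_mul]
    rw [ENNReal.toReal_ofReal (hu0 x), mul_comm]
  have h2 : IntegrableOn F (Iic A) ν := by
    refine Measure.integrableOn_of_bounded (M := B) (measure_ne_top ν _) hF.aestronglyMeasurable ?_
    filter_upwards [ae_restrict_mem measurableSet_Iic,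
      ae_restrict_of_ae (ae_nonneg_of_measure_Iio_zero hν0)] with x hx hx0
    exact hbdd x ⟨hx0, hx⟩
  rw [← integrableOn_univ, ← Iic_union_Ioi (a := A)]
  exact h2.union h1

theorem sqrt_half_sub_rpow_le {β x : ℝ} (hβ : 1 / 2 ≤ β) (hx : 0 < x) :
    1 / 2 * √x + -(x ^ β) ≤ 1 + -(1 / 2) * x ^ (1 / 2 : ℝ) := by
  rw [← Real.sqrt_eq_rpow]
  rcases le_total 1 x with h | h
  · have := Real.rpow_le_rpow_of_exponent_le h hβ
    rw [← Real.sqrt_eq_rpow] at this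
    linarith
  · have := Real.sqrt_le_one.2 h
    have := Real.rpow_pos_of_pos hx β
    linarith

theorem integrableOn_cosh_sqrt_mul_exp_neg_rpow {β : ℝ} (hβ : 1 / 2 ≤ β) :
    IntegrableOn (fun x => Real.cosh (1 / 2 * √x) * Real.exp (-(x ^ β))) (Ioi 0) := by
  have h := integrableOn_rpow_mul_exp_neg_mul_rpow (s := 0) (p := 1 / 2) (b := 1 / 2)
    (by norm_num) (by norm_num) (by norm_num)
  have hm : Measurable fun x : ℝ => Real.cosh (1 / 2 * √x) :=
    Real.measurable_cosh.comp (by fun_prop)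
  refine Integrable.mono' (h.const_mul (Real.exp 1))
    (hm.mul (by fun_prop)).aestronglyMeasurable ?_
  filter_upwards [ae_restrict_mem measurableSet_Ioi] with x hx
  rw [Real.norm_of_nonneg (mul_nonneg (Real.cosh_pos _).le (Real.exp_pos _).le), Real.rpow_zero,
    one_mul, ← Real.exp_add]
  have h1 : Real.cosh (1 / 2 * √x) ≤ Real.exp (1 / 2 * √x) := by
    rw [Real.cosh_eq]
    have : Real.exp (-(1 / 2 * √x)) ≤ Real.exp (1 / 2 * √x) :=
      Real.exp_le_exp.2 (by linarith [Real.sqrt_nonneg x])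
    linarith
  refine (mul_le_mul_of_nonneg_right h1 (Real.exp_pos _).le).trans ?_
  rw [← Real.exp_add]
  exact Real.exp_le_exp.2 (sqrt_half_sub_rpow_le hβ hx)

/-- A density `ν(x) ≍ exp(-x^β)` has all moments finite, and `ν` is moment determinate
if and only if `β ≥ 1/2`. -/
theorem exp_pow_density_determinate_iff
    (β : ℝ) (hβ : 0 < β)
    (ν : Measure ℝ) [IsProbabilityMeasure ν] (hsupp : SupportIsIci ν)
    (f : ℝ → ℝ) (hf : ν = volume.withDensity (fun x => ENNReal.ofReal (f x)))
    (C A : ℝ) (hC : 1 ≤ C) (hA : 0 < A)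
    (hfb : ∀ x : ℝ, A ≤ x →
      C⁻¹ * Real.exp (-(x ^ β)) ≤ f x ∧ f x ≤ C * Real.exp (-(x ^ β))) :
    (∀ n : ℕ, Integrable (fun x => x ^ n) ν) ∧
    (MomentDeterminate ν ↔ (1 / 2 : ℝ) ≤ β) := by
  have hC0 : 0 < C := by linarith
  have hν0 := hsupp.1
  have hres : ν.restrict (Ioi A)
      = (volume.restrict (Ioi A)).withDensity (fun x => ENNReal.ofReal (f x)) := by
    rw [hf, restrict_withDensity measurableSet_Ioi]
  have hupper : ν.restrict (Ioi A) ≤ (volume.restrict (Ioi A)).withDensity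
      (fun x => ENNReal.ofReal (C * Real.exp (-(x ^ β)))) := by
    rw [hres]
    refine withDensity_mono ?_
    filter_upwards [ae_restrict_mem measurableSet_Ioi] with x hx
    exact ENNReal.ofReal_le_ofReal (hfb x (le_of_lt hx)).2
  have hlower : (volume.restrict (Ioi A)).withDensity
      (fun x => ENNReal.ofReal (C⁻¹ * Real.exp (-(x ^ β)))) ≤ ν := by
    refine le_trans ?_ (Measure.restrict_le_self (s := Ioi A))
    rw [hres]
    refine withDensity_mono ?_
    filter_upwards [ae_restrict_mem measurableSet_Ioi] with x hx
    exact ENNReal.ofReal_le_ofReal (hfb x (le_of_lt hx)).1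
  have hint : ∀ n : ℕ, Integrable (fun x => x ^ n) ν := by
    intro n
    refine integrable_of_restrict_Ioi_le_withDensity hν0 hA.le (B := A ^ n) (by fun_prop)
      (fun x => by positivity) (by fun_prop) hupper (fun x hx => ?_) ?_
    · rw [abs_of_nonneg (pow_nonneg hx.1 n)]
      exact pow_le_pow_left₀ hx.1 hx.2 n
    · have h := integrableOn_rpow_mul_exp_neg_rpow (s := n)
        (by linarith [n.cast_nonneg (α := ℝ)]) hβ
      refine (h.const_mul C).congr (ae_of_all _ fun x => ?_)
      simp only [Real.rpow_natCast]
      ring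
  refine ⟨hint, fun hdet => ?_, fun hβ2 => ?_⟩
  · by_contra hlt
    exact not_momentDeterminate_of_withDensity_le hν0 hint hβ (not_le.1 hlt) (inv_pos.2 hC0) hA.le
      hlower hdet
  · have hcosh : Integrable (fun x => Real.cosh (1 / 2 * √x)) ν := by
      refine integrable_of_restrict_Ioi_le_withDensity hν0 hA.le (B := Real.cosh (1 / 2 * √A))
        (by fun_prop) (fun x => by positivity) (Real.measurable_cosh.comp (by fun_prop)) hupper
        (fun x hx => ?_) ?_
      · rw [abs_of_pos (Real.cosh_pos _), Real.cosh_le_cosh, abs_of_nonneg (by positivity),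
          abs_of_nonneg (by positivity)]
        exact mul_le_mul_of_nonneg_left (Real.sqrt_le_sqrt hx.2) (by norm_num)
      · refine ((integrableOn_cosh_sqrt_mul_exp_neg_rpow hβ2).const_mul C).congr
          (ae_of_all _ fun x => ?_)
        ring
    exact fun μ hμ0 hμ hM => eq_of_moments_eq_of_integrable_cosh_sqrt hμ0 hν0 hμ hint hM
      one_half_pos hcosh
end
end
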